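/- There is no spectral set of size 14 in 𝔽_7^3. -/

import Mathlib

open Finset

/-- The character `x ↦ e^{2πi (x·a)/p}` on `𝔽_p^d`. -/
noncomputable def chr (p : ℕ) {d : ℕ} (a x : Fin d → ZMod p) : ℂ :=
  Complex.exp (2 * (Real.pi : ℂ) * Complex.I *
    ((ZMod.val (∑ i, x i * a i) : ℕ) : ℂ) / (p : ℂ))

/-- `(E, A)` is a spectral pair: the characters `χ_a`, `a ∈ A`, restricted to `E`,
are pairwise orthogonal, span `L²(E)`, and are linearly independent, i.e. they
form an orthogonal basis of `L²(E)`. -/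
def IsSpectralPair (p : ℕ) {d : ℕ} (E A : Finset (Fin d → ZMod p)) : Prop :=
  (∀ a ∈ A, ∀ b ∈ A, a ≠ b →
    ∑ x ∈ E, chr p a x * (starRingEnd ℂ) (chr p b x) = 0) ∧
  (∀ f : E → ℂ, ∃ c : A → ℂ, ∀ x : E, f x = ∑ a : A, c a * chr p a.1 x.1) ∧
  (∀ c : A → ℂ, (∀ x : E, ∑ a : A, c a * chr p a.1 x.1 = 0) → ∀ a, c a = 0)

/-- `E` is a spectral set. -/
def IsSpectral (p : ℕ) {d : ℕ} (E : Finset (Fin d → ZMod p)) : Prop :=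
  ∃ A, IsSpectralPair p E A

/-- `E` tiles `𝔽_p^d` by translation. -/
def Tiles (p : ℕ) {d : ℕ} (E : Finset (Fin d → ZMod p)) : Prop :=
  ∃ A : Finset (Fin d → ZMod p),
    ∀ x, (∑ a ∈ A, if x - a ∈ E then (1 : ℕ) else 0) = 1

/-- `E` determines the direction (one-dimensional subspace) `D`. -/
def Determines (p : ℕ) {d : ℕ} (E : Finset (Fin d → ZMod p))
    (D : Submodule (ZMod p) (Fin d → ZMod p)) : Prop :=
  ∃ e₁ ∈ E, ∃ e₂ ∈ E, e₁ ≠ e₂ ∧ e₁ - e₂ ∈ D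

/-- The Fourier transform of the indicator function of `E`. -/
noncomputable def ftE (p : ℕ) {d : ℕ} (E : Finset (Fin d → ZMod p))
    (ξ : Fin d → ZMod p) : ℂ :=
  ((p : ℂ) ^ d)⁻¹ * ∑ x ∈ E, Complex.exp (-(2 * (Real.pi : ℂ) * Complex.I *
    ((ZMod.val (∑ i, x i * ξ i) : ℕ) : ℂ) / (p : ℂ)))

/-- The orthogonal set `S^⊥ = {x : x · y = 0 for all y ∈ S}`. -/
def perpSet (p : ℕ) {d : ℕ} (S : Submodule (ZMod p) (Fin d → ZMod p)) :
    Set (Fin d → ZMod p) :=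
  {x | ∀ y ∈ S, ∑ i, x i * y i = 0}



abbrev V3 := Fin 3 → ZMod 7

instance fact7 : Fact (Nat.Prime 7) := ⟨by norm_num⟩

def dt (x u : V3) : ZMod 7 := x 0 * u 0 + x 1 * u 1 + x 2 * u 2

def cr (a b : V3) : V3 :=
  ![a 1 * b 2 - a 2 * b 1, a 2 * b 0 - a 0 * b 2, a 0 * b 1 - a 1 * b 0]

theorem dt_comm (x u : V3) : dt x u = dt u x := by simp only [dt]; ring
theorem dt_sub (x u v : V3) : dt x (u - v) = dt x u - dt x v := by
  simp only [dt, Pi.sub_apply]; ring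
theorem dt_add (x u v : V3) : dt x (u + v) = dt x u + dt x v := by
  simp only [dt, Pi.add_apply]; ring
theorem dt_smul (x u : V3) (t : ZMod 7) : dt x (t • u) = t * dt x u := by
  simp only [dt, Pi.smul_apply, smul_eq_mul]; ring
theorem sub_dt (x u v : V3) : dt (u - v) x = dt u x - dt v x := by
  simp only [dt, Pi.sub_apply]; ring
theorem add_dt (x u v : V3) : dt (u + v) x = dt u x + dt v x := by
  simp only [dt, Pi.add_apply]; ring
theorem smul_dt (x u : V3) (t : ZMod 7) : dt (t • u) x = t * dt u x := by
  simp only [dt, Pi.smul_apply, smul_eq_mul]; ring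
theorem dt_zero (x : V3) : dt x 0 = 0 := by simp [dt]
theorem zero_dt (x : V3) : dt 0 x = 0 := by simp [dt]
theorem cr_zero (x : V3) : cr x 0 = 0 := by
  ext i; fin_cases i <;> simp [cr]
theorem zero_cr (x : V3) : cr 0 x = 0 := by
  ext i; fin_cases i <;> simp [cr]
theorem cr_self (x : V3) : cr x x = 0 := by
  ext i; fin_cases i <;> simp [cr] <;> ring
theorem cr_anti (x y : V3) : cr x y = - cr y x := by
  ext i; fin_cases i <;> simp [cr] <;> ring
theorem cr_eq_zero_comm {x y : V3} : cr x y = 0 ↔ cr y x = 0 := by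
  rw [cr_anti x y, neg_eq_zero]
theorem cr_smul (x y : V3) (t : ZMod 7) : cr x (t • y) = t • cr x y := by
  ext i; fin_cases i <;> simp [cr] <;> ring
theorem smul_cr (x y : V3) (t : ZMod 7) : cr (t • x) y = t • cr x y := by
  ext i; fin_cases i <;> simp [cr] <;> ring
theorem cr_add (x y z : V3) : cr x (y + z) = cr x y + cr x z := by
  ext i; fin_cases i <;> simp [cr] <;> ring
theorem cr_sub (x y z : V3) : cr x (y - z) = cr x y - cr x z := by
  ext i; fin_cases i <;> simp [cr] <;> ring
theorem dt_cr_left (x y : V3) : dt x (cr x y) = 0 := by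
  simp [cr, dt]; ring
theorem dt_cr_right (x y : V3) : dt y (cr x y) = 0 := by
  simp [cr, dt]; ring
theorem cr_dt_left (x y : V3) : dt (cr x y) x = 0 := by
  simp [cr, dt]; ring
theorem cr_dt_right (x y : V3) : dt (cr x y) y = 0 := by
  simp [cr, dt]; ring
/-- triple product -/
theorem cr_cr (x y z : V3) : cr x (cr y z) = dt x z • y - dt x y • z := by
  ext i; fin_cases i <;> simp [cr, dt] <;> ring
theorem dt_cr_cyc (x y z : V3) : dt x (cr y z) = dt y (cr z x) := by
  simp [cr, dt]; ring
theorem dt_expand (d e f u : V3) :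
    dt d (cr e f) • u = dt d u • cr e f + dt e u • cr f d + dt f u • cr d e := by
  ext i; fin_cases i <;> simp [cr, dt] <;> ring

/-- parallel to a nonzero vector -/
theorem par_smul {c u : V3} (hc : c ≠ 0) (h : cr c u = 0) : ∃ t : ZMod 7, u = t • c := by
  have h0 : c 1 * u 2 - c 2 * u 1 = 0 := by simpa [cr] using congrFun h 0
  have h1 : c 2 * u 0 - c 0 * u 2 = 0 := by simpa [cr] using congrFun h 1
  have h2 : c 0 * u 1 - c 1 * u 0 = 0 := by simpa [cr] using congrFun h 2
  have : ∃ i, c i ≠ 0 := by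
    by_contra hh; push Not at hh; exact hc (funext hh)
  obtain ⟨i, hi⟩ := this
  refine ⟨u i / c i, ?_⟩
  ext j
  simp only [Pi.smul_apply, smul_eq_mul]
  field_simp
  fin_cases i <;> fin_cases j <;> simp at * <;> first
    | linear_combination h0
    | linear_combination h1
    | linear_combination h2
    | linear_combination -h0
    | linear_combination -h1
    | linear_combination -h2
    | ring

theorem par_of_perp {d e u : V3} (h : cr d e ≠ 0) (h1 : dt d u = 0) (h2 : dt e u = 0) :
    ∃ t : ZMod 7, u = t • cr d e := by
  apply par_smul h
  rw [cr_eq_zero_comm, cr_cr, dt_comm u e, dt_comm u d, h1, h2]; simp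

theorem exists_dt_one {d : V3} (h : d ≠ 0) : ∃ w, dt d w = 1 := by
  have : ∃ i, d i ≠ 0 := by
    by_contra hh; push Not at hh; exact h (funext hh)
  obtain ⟨i, hi⟩ := this
  refine ⟨Pi.single i (d i)⁻¹, ?_⟩
  fin_cases i <;> simp [dt] at * <;> exact mul_inv_cancel₀ hi

theorem exists_nonpar {d : V3} (h : d ≠ 0) : ∃ e, cr d e ≠ 0 := by
  by_contra hh
  push Not at hh
  obtain ⟨t, ht⟩ := par_smul h (hh ![1,0,0])
  obtain ⟨s, hs⟩ := par_smul h (hh ![0,1,0])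
  have a0 := congrFun ht 0
  have a1 := congrFun ht 1
  have b0 := congrFun hs 0
  have b1 := congrFun hs 1
  simp at a0 a1 b0 b1
  grind

theorem smul_inj {d : V3} (h : d ≠ 0) {s t : ZMod 7} (hst : s • d = t • d) : s = t :=
  smul_left_injective (ZMod 7) h hst

/-- number of vectors orthogonal to two nonparallel ones -/
theorem card_perp2 {d e : V3} (h : cr d e ≠ 0) :
    (univ.filter fun u : V3 => dt d u = 0 ∧ dt e u = 0).card = 7 := by
  have : (univ.filter fun u : V3 => dt d u = 0 ∧ dt e u = 0)
      = univ.image fun t : ZMod 7 => t • cr d e := by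
    ext u
    simp only [mem_filter, mem_univ, true_and, mem_image]
    constructor
    · rintro ⟨h1, h2⟩
      obtain ⟨t, ht⟩ := par_of_perp h h1 h2
      exact ⟨t, ht.symm⟩
    · rintro ⟨t, rfl⟩
      simp [dt_smul, dt_cr_left, dt_cr_right]
  rw [this, card_image_of_injective _ (smul_left_injective (ZMod 7) h)]
  simp [ZMod.card]

theorem card_perp {d : V3} (h : d ≠ 0) :
    (univ.filter fun u : V3 => dt d u = 0).card = 49 := by
  obtain ⟨w, hw⟩ := exists_dt_one h
  have key : ∀ c : ZMod 7, (univ.filter fun u : V3 => dt d u = c).card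
      = (univ.filter fun u : V3 => dt d u = 0).card := by
    intro c
    refine (card_bij (fun u _ => u + c • w) ?_ ?_ ?_).symm
    · intro u hu
      simp only [mem_filter, mem_univ, true_and] at hu ⊢
      rw [dt_add, dt_smul, hu, hw]; ring
    · intro a _ b _ hab
      exact add_right_cancel hab
    · intro b hb
      simp only [mem_filter, mem_univ, true_and] at hb
      refine ⟨b - c • w, ?_, by simp⟩
      simp only [mem_filter, mem_univ, true_and]
      rw [dt_sub, dt_smul, hb, hw]; ring
  have tot := card_eq_sum_card_fiberwise (s := (univ : Finset V3)) (t := (univ : Finset (ZMod 7)))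
    (f := fun u => dt d u) (by intro x _; simp)
  simp only [key] at tot
  have c1 : (univ : Finset V3).card = 343 := by
    rw [card_univ, Fintype.card_fun, ZMod.card]; simp
  rw [c1, sum_const, card_univ, ZMod.card] at tot
  simp only [smul_eq_mul] at tot
  omega

theorem card_par {d : V3} (h : d ≠ 0) :
    (univ.filter fun u : V3 => cr d u = 0).card = 7 := by
  have : (univ.filter fun u : V3 => cr d u = 0)
      = univ.image fun t : ZMod 7 => t • d := by
    ext u
    simp only [mem_filter, mem_univ, true_and, mem_image]
    constructor
    · intro h1
      obtain ⟨t, ht⟩ := par_smul h h1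
      exact ⟨t, ht.symm⟩
    · rintro ⟨t, rfl⟩
      simp [cr_smul, cr_self]
  rw [this, card_image_of_injective _ (smul_left_injective (ZMod 7) h)]
  simp [ZMod.card]

theorem card_V3 : (univ : Finset V3).card = 343 := by
  rw [card_univ, Fintype.card_fun, ZMod.card]; simp

theorem dc {α β : Type*} (s : Finset α) (t : Finset β) (r : α → β → Prop)
    [∀ a b, Decidable (r a b)] :
    ∑ a ∈ s, (t.filter fun b => r a b).card = ∑ b ∈ t, (s.filter fun a => r a b).card := by
  simp only [card_filter]
  exact sum_comm

def Bal (E : Finset V3) (u : V3) : Prop := ∀ c, (E.filter fun x => dt x u = c).card = 2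

def Dir (A : Finset V3) (u : V3) : Prop :=
  u ≠ 0 ∧ ∃ a ∈ A, ∃ b ∈ A, a ≠ b ∧ cr u (a - b) = 0

structure SP (E A : Finset V3) : Prop where
  cE : E.card = 14
  cA : A.card = 14
  bE : ∀ a ∈ A, ∀ b ∈ A, a ≠ b → Bal E (a - b)
  bA : ∀ a ∈ E, ∀ b ∈ E, a ≠ b → Bal A (a - b)

theorem SP.symm {E A : Finset V3} (h : SP E A) : SP A E := ⟨h.cA, h.cE, h.bA, h.bE⟩

theorem Bal.smul {E : Finset V3} {u : V3} (h : Bal E u) {t : ZMod 7} (ht : t ≠ 0) :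
    Bal E (t • u) := by
  intro c
  rw [← h (c / t)]
  congr 1
  apply filter_congr
  intro x _
  rw [dt_smul, eq_div_iff ht, mul_comm]

theorem SP.bal {E A : Finset V3} (h : SP E A) {u : V3} (hu : Dir A u) : Bal E u := by
  obtain ⟨h0, a, ha, b, hb, hab, hc⟩ := hu
  have hne : a - b ≠ 0 := sub_ne_zero.mpr hab
  obtain ⟨t, ht⟩ := par_smul hne (cr_eq_zero_comm.mp hc)
  have : t ≠ 0 := by rintro rfl; simp at ht; exact h0 ht
  rw [ht]
  exact (h.bE a ha b hb hab).smul this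

theorem SP.blocking {E A : Finset V3} (h : SP E A) (d : V3) :
    ∃ a ∈ A, ∃ b ∈ A, a ≠ b ∧ dt d (a - b) = 0 := by
  have : (univ : Finset (ZMod 7)).card < A.card := by
    rw [h.cA, card_univ, ZMod.card]; norm_num
  obtain ⟨a, ha, b, hb, hab, he⟩ := exists_ne_map_eq_of_card_lt_of_maps_to this
    (f := fun a => dt d a) (by intro x _; simp)
  exact ⟨a, ha, b, hb, hab, by rw [dt_sub]; simpa [sub_eq_zero] using he⟩

/-- lines contain at most two points -/
theorem SP.cap {E A : Finset V3} (h : SP E A) {u v : V3} (huv : cr u v ≠ 0) (c c' : ZMod 7) :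
    (E.filter fun x => dt x u = c ∧ dt x v = c').card ≤ 2 := by
  obtain ⟨a, ha, b, hb, hab, he⟩ := h.blocking (cr u v)
  by_contra hlt
  obtain ⟨x0, hx0⟩ : (E.filter fun x => dt x u = c ∧ dt x v = c').Nonempty := by
    rw [← card_pos]; omega
  have hsub : (E.filter fun x => dt x u = c ∧ dt x v = c') ⊆
      E.filter fun x => dt x (a - b) = dt x0 (a - b) := by
    intro x hx
    simp only [mem_filter] at hx hx0 ⊢
    refine ⟨hx.1, ?_⟩
    obtain ⟨t, ht⟩ := par_of_perp (u := x - x0) huv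
      (by rw [dt_sub, dt_comm u, dt_comm u, hx.2.1, hx0.2.1, sub_self])
      (by rw [dt_sub, dt_comm v, dt_comm v, hx.2.2, hx0.2.2, sub_self])
    have := sub_dt (a - b) x x0
    rw [ht, smul_dt, he, mul_zero] at this
    exact sub_eq_zero.mp this.symm
  have := card_le_card hsub
  rw [h.bE a ha b hb hab] at this
  omega

theorem card_perp_ne {d : V3} (h : d ≠ 0) :
    (univ.filter fun u : V3 => u ≠ 0 ∧ dt d u = 0).card = 48 := by
  have : (univ.filter fun u : V3 => u ≠ 0 ∧ dt d u = 0)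
      = (univ.filter fun u : V3 => dt d u = 0).erase 0 := by
    ext u; simp
  rw [this, card_erase_of_mem (by simp [dt_zero]), card_perp h]

theorem card_perp2_ne {d e : V3} (h : cr d e ≠ 0) :
    (univ.filter fun u : V3 => u ≠ 0 ∧ dt d u = 0 ∧ dt e u = 0).card = 6 := by
  have : (univ.filter fun u : V3 => u ≠ 0 ∧ dt d u = 0 ∧ dt e u = 0)
      = (univ.filter fun u : V3 => dt d u = 0 ∧ dt e u = 0).erase 0 := by
    ext u; simp
  rw [this, card_erase_of_mem (by simp [dt_zero]), card_perp2 h]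

theorem bal_diff {E : Finset V3} {u : V3} (h : Bal E u) (x : V3) :
    (E.filter fun y => dt (y - x) u = 0).card = 2 := by
  rw [← h (dt x u)]
  congr 1
  apply filter_congr
  intro y _
  rw [sub_dt, sub_eq_zero]

/-- no full line of balanced directions -/
theorem not_all_bal {E : Finset V3} (hE : E.card = 14) {d : V3} (hd : d ≠ 0) :
    ∃ u, u ≠ 0 ∧ dt d u = 0 ∧ ¬ Bal E u := by
  by_contra hcon
  push Not at hcon
  obtain ⟨x, hx⟩ : E.Nonempty := by rw [← card_pos]; omega
  have key := dc (univ.filter fun u : V3 => u ≠ 0 ∧ dt d u = 0) E (fun u y => dt (y - x) u = 0)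
  have hl : ∑ u ∈ (univ.filter fun u : V3 => u ≠ 0 ∧ dt d u = 0),
      (E.filter fun y => dt (y - x) u = 0).card = 48 * 2 := by
    rw [sum_congr rfl (g := fun _ => 2), sum_const, card_perp_ne hd, smul_eq_mul]
    intro u hu
    simp only [mem_filter, mem_univ, true_and] at hu
    exact bal_diff (hcon u hu.1 hu.2) x
  have hr : ∀ y ∈ E, ((univ.filter fun u : V3 => u ≠ 0 ∧ dt d u = 0).filter
      fun u => dt (y - x) u = 0).card = if cr d (y - x) = 0 then 48 else 6 := by
    intro y _
    rw [filter_filter]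
    split_ifs with hc
    · obtain ⟨t, ht⟩ := par_smul hd hc
      rw [← card_perp_ne hd]
      congr 1
      apply filter_congr
      intro u _
      rw [ht, smul_dt]
      constructor
      · rintro ⟨h1, h2⟩; exact h1
      · rintro ⟨h1, h2⟩; exact ⟨⟨h1, h2⟩, by rw [h2, mul_zero]⟩
    · refine Eq.trans ?_ (card_perp2_ne hc)
      congr 1
      apply filter_congr
      intro u _
      tauto
  rw [hl, sum_congr rfl hr, sum_ite, sum_const, sum_const, smul_eq_mul, smul_eq_mul] at key
  have := card_filter_add_card_filter_not (s := E) (fun y => cr d (y - x) = 0)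
  omega

theorem SP.missing {E A : Finset V3} (h : SP E A) {d : V3} (hd : d ≠ 0) :
    ∃ u, u ≠ 0 ∧ dt d u = 0 ∧ ¬ Dir A u := by
  obtain ⟨u, h1, h2, h3⟩ := not_all_bal h.cE hd
  exact ⟨u, h1, h2, fun h' => h3 (h.bal h')⟩

/-- E is not contained in a plane -/
theorem SP.noplane {E A : Finset V3} (h : SP E A) {v : V3} (hv : v ≠ 0) (c : ZMod 7) :
    ∃ x ∈ E, dt x v ≠ c := by
  by_contra hcon
  push Not at hcon
  obtain ⟨d, d0, dv, hd⟩ := h.symm.missing hv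
  -- a plane through d different from v's
  have : ∃ g, dt d g = 0 ∧ cr v g ≠ 0 := by
    obtain ⟨e, he⟩ := exists_nonpar d0
    by_contra hh
    push Not at hh
    have c1 : (univ.filter fun u : V3 => dt d u = 0) ⊆ univ.filter fun u : V3 => cr v u = 0 := by
      intro u hu
      simp only [mem_filter, mem_univ, true_and] at hu ⊢
      exact hh u hu
    have := card_le_card c1
    rw [card_perp d0, card_par hv] at this
    omega
  obtain ⟨g, hg, hgv⟩ := this
  obtain ⟨x, hx, y, hy, hxy, he⟩ := h.symm.blocking g
  apply hd
  refine ⟨d0, x, hx, y, hy, hxy, ?_⟩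
  have h1 : dt v (x - y) = 0 := by
    rw [dt_sub, dt_comm v, dt_comm v, hcon x hx, hcon y hy, sub_self]
  obtain ⟨s, hs⟩ := par_of_perp hgv h1 he
  obtain ⟨t, ht⟩ := par_of_perp (u := d) hgv dv (by rw [dt_comm]; exact hg)
  rw [hs, ht, cr_smul, smul_cr, cr_self]; simp

theorem SP.seven {E A : Finset V3} (h : SP E A) {d v : V3} (hd : d ≠ 0) (hv : v ≠ 0)
    (hdv : dt d v = 0) (hb : ∀ u, dt d u = 0 → cr v u ≠ 0 → Bal E u) :
    ∀ x ∈ E, (E.filter fun y => dt y v = dt x v).card = 7 ∧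
      ∀ y ∈ E, cr d (y - x) = 0 → y = x := by
  intro x hx
  have key := dc (univ.filter fun u : V3 => dt d u = 0 ∧ cr v u ≠ 0) E
    (fun u y => dt (y - x) u = 0)
  have c42 : (univ.filter fun u : V3 => dt d u = 0 ∧ cr v u ≠ 0).card = 42 := by
    have h1 := card_filter_add_card_filter_not (s := univ.filter fun u : V3 => dt d u = 0)
      (fun u => cr v u = 0)
    rw [filter_filter, filter_filter, card_perp hd] at h1
    have h2 : (univ.filter fun u : V3 => dt d u = 0 ∧ cr v u = 0).card = 7 := by
      refine Eq.trans ?_ (card_par hv)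
      congr 1
      apply filter_congr
      intro u _
      constructor
      · exact fun h => h.2
      · intro hc
        obtain ⟨t, ht⟩ := par_smul hv hc
        exact ⟨by rw [ht, dt_smul, hdv, mul_zero], hc⟩
    rw [h2] at h1
    have h3 : 7 + (univ.filter fun u : V3 => dt d u = 0 ∧ cr v u ≠ 0).card = 49 := h1
    omega
  have hl : ∑ u ∈ (univ.filter fun u : V3 => dt d u = 0 ∧ cr v u ≠ 0),
      (E.filter fun y => dt (y - x) u = 0).card = 42 * 2 := by
    rw [sum_congr rfl (g := fun _ => 2), sum_const, c42, smul_eq_mul]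
    intro u hu
    simp only [mem_filter, mem_univ, true_and] at hu
    exact bal_diff (hb u hu.1 hu.2) x
  have hr : ∀ y ∈ E, ((univ.filter fun u : V3 => dt d u = 0 ∧ cr v u ≠ 0).filter
      fun u => dt (y - x) u = 0).card =
      (if cr d (y - x) = 0 then 42 else 0) + (if dt y v = dt x v then 0 else 6) := by
    intro y _
    rw [filter_filter]
    by_cases hc : cr d (y - x) = 0
    · obtain ⟨t, ht⟩ := par_smul hd hc
      have : dt y v = dt x v := by
        have := sub_dt v y x
        rw [ht, smul_dt, hdv, mul_zero] at this
        exact sub_eq_zero.mp this.symm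
      rw [if_pos hc, if_pos this, add_zero]; refine Eq.trans ?_ c42
      congr 1
      apply filter_congr
      intro u _
      rw [ht, smul_dt]
      constructor
      · rintro ⟨h1, h2⟩; exact h1
      · rintro ⟨h1, h2⟩; exact ⟨⟨h1, h2⟩, by rw [h1, mul_zero]⟩
    · rw [if_neg hc, zero_add]
      obtain ⟨k, hk⟩ : ∃ k, k = y - x := ⟨_, rfl⟩
      have hkv : dt k v = dt y v - dt x v := by rw [hk, sub_dt]
      rw [← hk] at hc ⊢
      split_ifs with hyx
      · rw [card_eq_zero, filter_eq_empty_iff]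
        rintro u - ⟨⟨h1, h2⟩, h3⟩
        obtain ⟨s, hs⟩ := par_of_perp hc h1 h3
        obtain ⟨t, ht⟩ := par_of_perp (u := v) hc hdv (by rw [hkv, hyx, sub_self])
        apply h2
        rw [hs, ht, cr_smul, smul_cr, cr_self]; simp
      · refine Eq.trans ?_ (card_perp2_ne hc)
        congr 1
        apply filter_congr
        intro u _
        constructor
        · rintro ⟨⟨h1, h2⟩, h3⟩
          refine ⟨?_, h1, h3⟩
          rintro rfl
          exact h2 (cr_zero v)
        · rintro ⟨h1, h2, h3⟩
          refine ⟨⟨h2, ?_⟩, h3⟩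
          intro h4
          obtain ⟨t, ht⟩ := par_smul h1 (cr_eq_zero_comm.mp h4)
          have : dt k v = 0 := by rw [ht, dt_smul, h3, mul_zero]
          rw [hkv, sub_eq_zero] at this
          exact hyx this
  rw [hl, sum_congr rfl hr, sum_add_distrib, sum_ite, sum_ite, sum_const, sum_const, sum_const,
    sum_const, smul_eq_mul, smul_eq_mul, smul_eq_mul, smul_eq_mul] at key
  have e1 := card_filter_add_card_filter_not (s := E) (fun y => cr d (y - x) = 0)
  have e2 := card_filter_add_card_filter_not (s := E) (fun y => dt y v = dt x v)
  have hE := h.cE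
  -- not all in plane
  obtain ⟨z, hz, hzv⟩ := h.noplane hv (dt x v)
  have e3 : 0 < (E.filter fun y => ¬ dt y v = dt x v).card :=
    card_pos.mpr ⟨z, by simp [hz, hzv]⟩
  have e4 : x ∈ E.filter fun y => cr d (y - x) = 0 := by simp [hx, cr_zero]
  have e5 : 0 < (E.filter fun y => cr d (y - x) = 0).card := card_pos.mpr ⟨x, e4⟩
  have e6 : (E.filter fun y => cr d (y - x) = 0).card = 1 := by omega
  refine ⟨by omega, ?_⟩
  intro y hy hc
  rw [card_eq_one] at e6
  obtain ⟨w, hw⟩ := e6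
  have : y ∈ E.filter fun y => cr d (y - x) = 0 := by simp [hy, hc]
  rw [hw, mem_singleton] at this e4
  rw [this, e4]

theorem fib_sum {α : Type*} (R : Finset α) (φ : α → ZMod 7) :
    ∑ c : ZMod 7, (R.filter fun p => φ p = c).card = R.card := by
  rw [card_eq_sum_card_fiberwise (f := φ) (t := univ) (by intro x _; simp)]

theorem offdiag_sq {α : Type*} [DecidableEq α] (R : Finset α) (φ : α → ZMod 7) :
    (R.offDiag.filter fun p => φ p.1 = φ p.2).card + R.card
      = ∑ c : ZMod 7, (R.filter fun p => φ p = c).card ^ 2 := by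
  have h1 : ((R ×ˢ R).filter fun p => φ p.1 = φ p.2).card
      = ∑ c : ZMod 7, (R.filter fun p => φ p = c).card ^ 2 := by
    rw [card_eq_sum_card_fiberwise (f := fun p => φ p.1) (t := univ) (by intro x _; simp)]
    apply sum_congr rfl
    intro c _
    rw [sq, ← card_product]
    congr 1
    ext ⟨p, q⟩
    simp only [mem_filter, mem_product]
    constructor
    · rintro ⟨⟨⟨h1, h2⟩, h3⟩, h4⟩; exact ⟨⟨h1, h4⟩, h2, by rw [← h3, h4]⟩
    · rintro ⟨⟨h1, h4⟩, h2, h3⟩; exact ⟨⟨⟨h1, h2⟩, by rw [h3, h4]⟩, h4⟩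
  rw [← h1, ← diag_union_offDiag, filter_union, card_union_of_disjoint, add_comm]
  · congr 1
    rw [filter_true_of_mem, diag_card]
    intro x hx
    rw [mem_diag] at hx
    rw [hx.2]
  · exact disjoint_filter_filter (disjoint_diag_offDiag R)

theorem nfib {α : Type*} [DecidableEq α] (R : Finset α) (φ : α → ZMod 7)
    (h : ∀ c, (R.filter fun p => φ p = c).card ≤ 2) :
    ∃ t, (R.offDiag.filter fun p => φ p.1 = φ p.2).card = 2 * t ∧ 2 * t ≤ R.card ∧
      ((∀ c, ∃ p ∈ R, φ p = c) → t + 7 = R.card) := by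
  have h1 := offdiag_sq R φ
  have h2 := fib_sum R φ
  refine ⟨∑ c : ZMod 7, if (R.filter fun p => φ p = c).card = 2 then 1 else 0, ?_, ?_, ?_⟩
  · have : ∑ c : ZMod 7, (R.filter fun p => φ p = c).card ^ 2 =
      2 * (∑ c : ZMod 7, if (R.filter fun p => φ p = c).card = 2 then 1 else 0) + R.card := by
      rw [← h2, mul_sum, ← sum_add_distrib]
      apply sum_congr rfl
      intro c _
      have := h c
      generalize (R.filter fun p => φ p = c).card = k at *
      interval_cases k <;> simp
    omega
  · rw [← h2, mul_sum]
    apply sum_le_sum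
    intro c _
    split_ifs <;> omega
  · intro hs
    have : ∑ c : ZMod 7, 1 = 7 := by simp
    suffices hh : (∑ c : ZMod 7, if (R.filter fun p => φ p = c).card = 2 then 1 else 0)
        + ∑ c : ZMod 7, 1 = R.card by rw [this] at hh; exact hh
    rw [← h2, ← sum_add_distrib]
    apply sum_congr rfl
    intro c _
    obtain ⟨p, hp, hc⟩ := hs c
    have h3 : 0 < (R.filter fun p => φ p = c).card := card_pos.mpr ⟨p, by simp [hp, hc]⟩
    have := h c
    split_ifs <;> omega

theorem lemmaY (R : Finset (ZMod 7 × ZMod 7))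
    (s1 : ∀ c, ∃ p ∈ R, p.1 = c) (s2 : ∀ c, ∃ p ∈ R, p.2 = c)
    (l1 : ∀ c, (R.filter fun p => p.1 = c).card ≤ 2)
    (l2 : ∀ m c, (R.filter fun p => p.2 - m * p.1 = c).card ≤ 2) : False := by
  obtain ⟨t1, a1, b1, c1⟩ := nfib R (fun p => p.1) l1
  replace c1 := c1 s1
  choose t a b c using fun m => nfib R (fun p => p.2 - m * p.1) (l2 m)
  have c0 := c 0 (by simpa using s2)
  have hcov : R.offDiag ⊆ (R.offDiag.filter fun p => p.1.1 = p.2.1) ∪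
      univ.biUnion fun m : ZMod 7 =>
        R.offDiag.filter fun p => p.1.2 - m * p.1.1 = p.2.2 - m * p.2.1 := by
    rintro ⟨⟨x, y⟩, ⟨x', y'⟩⟩ hp
    simp only [mem_union, mem_filter, mem_biUnion, mem_univ, true_and, hp]
    by_cases h : x = x'
    · left; exact h
    · right
      have : x - x' ≠ 0 := sub_ne_zero.mpr h
      refine ⟨(y - y') / (x - x'), ?_⟩
      field_simp
      ring
  have h1 := (card_le_card hcov).trans ((card_union_le _ _).trans
    (Nat.add_le_add_left card_biUnion_le _))
  rw [offDiag_card, a1, sum_congr rfl (fun m _ => a m)] at h1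
  have h2 : ∑ m : ZMod 7, 2 * t m = 2 * t 0 + ∑ m ∈ univ.erase (0 : ZMod 7), 2 * t m := by
    rw [← insert_erase (mem_univ (0 : ZMod 7)), sum_insert (notMem_erase _ _)]
    simp
  have ce : (univ.erase (0 : ZMod 7)).card = 6 := by
    rw [card_erase_of_mem (mem_univ _), card_univ, ZMod.card]
  have h3 : ∑ m ∈ univ.erase (0 : ZMod 7), 2 * t m ≤ 6 * R.card := by
    have := sum_le_card_nsmul (univ.erase (0 : ZMod 7)) (fun m => 2 * t m) R.card
      (fun m _ => b m)
    rwa [ce, smul_eq_mul] at this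
  rw [h2] at h1
  have hg : R.card = 7 := by
    have h5 : R.card * R.card ≤ 11 * R.card - 28 := by omega
    have : R.card ≤ 7 := by
      by_contra hc
      have : R.card * R.card + 28 ≤ 11 * R.card := by omega
      nlinarith
    omega
  have h4 : ∑ m ∈ univ.erase (0 : ZMod 7), 2 * t m ≤ 6 * 6 := by
    have := sum_le_card_nsmul (univ.erase (0 : ZMod 7)) (fun m => 2 * t m) 6
      (fun m _ => by have := b m; omega)
    rwa [ce, smul_eq_mul] at this
  rw [hg] at h1 c0 c1
  omega

theorem surj_of_inj {α : Type*} (S : Finset α) (φ : α → ZMod 7) (h7 : 7 ≤ S.card)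
    (hi : ∀ x ∈ S, ∀ y ∈ S, φ x = φ y → x = y) (c : ZMod 7) : ∃ x ∈ S, φ x = c := by
  have h1 : (S.image φ).card = S.card := card_image_of_injOn hi
  have h2 : S.image φ = univ := by
    apply eq_univ_of_card
    apply le_antisymm (card_le_univ _)
    rw [ZMod.card, h1]; exact h7
  have : c ∈ S.image φ := by rw [h2]; simp
  simpa using this

theorem SP.claim {E A : Finset V3} (h : SP E A) {v d w : V3} {c : ZMod 7} (hv : v ≠ 0)
    (d0 : d ≠ 0) (dv : dt v d = 0) (hd : ¬ Dir E d)
    (h7 : 7 ≤ (E.filter fun x => dt x v = c).card) (hw : dt v w = 0) (hwd : cr d w ≠ 0) :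
    Dir E w := by
  by_contra hnw
  have w0 : w ≠ 0 := by rintro rfl; exact hwd (cr_zero d)
  obtain ⟨z, hz⟩ := exists_dt_one hv
  have ht : ∀ g, dt v g = 0 → cr v (cr z g) = - g := by
    intro g hg
    rw [cr_cr, hg, hz]; simp
  have hinj : ∀ g, g ≠ 0 → dt v g = 0 → ¬ Dir E g → ∀ x ∈ E.filter fun x => dt x v = c,
      ∀ y ∈ E.filter fun x => dt x v = c, dt x (cr z g) = dt y (cr z g) → x = y := by
    intro g g0 hg hgd x hx y hy hxy
    by_contra hne
    apply hgd
    simp only [mem_filter] at hx hy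
    refine ⟨g0, x, hx.1, y, hy.1, hne, ?_⟩
    have hn : cr v (cr z g) ≠ 0 := by rw [ht g hg]; simpa using g0
    obtain ⟨t, ht'⟩ := par_of_perp (u := x - y) hn
      (by rw [dt_comm, sub_dt, hx.2, hy.2, sub_self])
      (by rw [dt_comm, sub_dt, hxy, sub_self])
    rw [ht', ht g hg, cr_smul, ← neg_one_smul (ZMod 7) g, cr_smul, cr_self]; simp
  have hline : ∀ g, g ≠ 0 → dt v g = 0 → ∀ c',
      ((E.filter fun x => dt x v = c).filter fun x => dt x (cr z g) = c').card ≤ 2 := by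
    intro g g0 hg c'
    rw [filter_filter]
    exact h.cap (by rw [ht g hg]; simpa using g0) _ _
  apply lemmaY ((E.filter fun x => dt x v = c).image fun x => (dt x (cr z w), dt x (cr z d)))
  · intro c'
    obtain ⟨x, hx, hc⟩ := surj_of_inj _ _ h7 (hinj w w0 hw hnw) c'
    exact ⟨_, mem_image_of_mem _ hx, hc⟩
  · intro c'
    obtain ⟨x, hx, hc⟩ := surj_of_inj _ _ h7 (hinj d d0 dv hd) c'
    exact ⟨_, mem_image_of_mem _ hx, hc⟩
  · intro c'
    rw [filter_image]
    exact card_image_le.trans (hline w w0 hw c')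
  · intro m c'
    rw [filter_image]
    refine card_image_le.trans ?_
    refine le_trans (le_of_eq ?_) (hline (d - m • w) ?_ ?_ c')
    · congr 1
      apply filter_congr
      intro x _
      rw [cr_sub, cr_smul, dt_sub, dt_smul]
    · intro h0
      apply hwd
      rw [sub_eq_zero.mp h0, smul_cr, cr_self, smul_zero]
    · rw [dt_sub, dt_smul, dv, hw, mul_zero, sub_zero]

theorem periodic_const {f : ZMod 7 → ℕ} {τ : ZMod 7} (hτ : τ ≠ 0) (h : ∀ c, f c = f (c + τ))
    (c : ZMod 7) : f c = f 0 := by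
  have : ∀ k : ℕ, f ((k : ZMod 7) * τ) = f 0 := by
    intro k
    induction k with
    | zero => simp
    | succ k ih => rw [← ih, h ((k : ZMod 7) * τ)]; congr 1; push_cast; ring
  have h2 := this (c / τ).val
  rw [ZMod.natCast_val, ZMod.cast_id] at h2
  rw [← h2]; congr 1; field_simp

theorem two_classes {E : Finset V3} (hE : E.card = 14) {v : V3} {c1 c2 : ZMod 7} (h12 : c1 ≠ c2)
    (h1 : (E.filter fun y => dt y v = c1).card = 7) (h2 : (E.filter fun y => dt y v = c2).card = 7)
    {y : V3} (hy : y ∈ E) : dt y v = c1 ∨ dt y v = c2 := by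
  have hd : Disjoint (E.filter fun y => dt y v = c1) (E.filter fun y => dt y v = c2) := by
    rw [disjoint_filter]; intro x _ h3 h4; exact h12 (h3.symm.trans h4)
  have : (E.filter fun y => dt y v = c1) ∪ (E.filter fun y => dt y v = c2) = E := by
    apply eq_of_subset_of_card_le
    · exact union_subset (filter_subset _ _) (filter_subset _ _)
    · rw [card_union_of_disjoint hd, h1, h2, hE]
  rw [← this] at hy
  simp only [mem_union, mem_filter] at hy
  tauto

theorem SP.no7 {E A : Finset V3} (h : SP E A) {v : V3} (hv : v ≠ 0) (c : ZMod 7) :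
    (E.filter fun x => dt x v = c).card ≤ 6 := by
  by_contra hlt
  have h7 : 7 ≤ (E.filter fun x => dt x v = c).card := by omega
  obtain ⟨d, d0, dv, hd⟩ := h.symm.missing hv
  have dv' : dt d v = 0 := by rw [dt_comm]; exact dv
  have clE : ∀ u, dt v u = 0 → cr d u ≠ 0 → Dir E u := fun u hu hu' =>
    h.claim hv d0 dv hd h7 hu hu'
  have sA := h.symm.seven hv d0 dv (fun u h1 h2 => h.symm.bal (clE u h1 h2))
  have hdA : ¬ Dir A v := by
    rintro ⟨_, a, ha, b, hb, hab, hc⟩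
    exact hab ((sA b hb).2 a ha hc)
  obtain ⟨a, ha⟩ : A.Nonempty := by rw [← card_pos, h.cA]; norm_num
  have clA : ∀ u, dt d u = 0 → cr v u ≠ 0 → Dir A u := fun u hu hu' =>
    h.symm.claim d0 hv dv' hdA (by rw [(sA a ha).1]) hu hu'
  have sE := h.seven d0 hv dv' (fun u h1 h2 => h.bal (clA u h1 h2))
  obtain ⟨x1, hx1⟩ : E.Nonempty := by rw [← card_pos, h.cE]; norm_num
  obtain ⟨x2, hx2, hx12⟩ := h.noplane hv (dt x1 v)
  obtain ⟨a2, ha2, haa⟩ := h.symm.noplane d0 (dt a d)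
  obtain ⟨a', ha', hne⟩ : ∃ a' ∈ A.filter (fun b => dt b d = dt a d), a' ≠ a := by
    apply exists_mem_ne
    rw [(sA a ha).1]; norm_num
  rw [mem_filter] at ha'
  obtain ⟨z, hz⟩ := exists_dt_one d0
  have hh0 : a' - a ≠ 0 := sub_ne_zero.mpr hne
  have hdh : dt d (a' - a) = 0 := by rw [dt_comm, sub_dt, ha'.2, sub_self]
  have clsE : ∀ y ∈ E, dt y v = dt x1 v ∨ dt y v = dt x2 v := fun y hy =>
    two_classes h.cE (Ne.symm hx12) (sE x1 hx1).1 (sE x2 hx2).1 hy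
  have cre : cr d (cr v z) = v := by rw [cr_cr, hz, dv']; simp
  have step : ∀ b ∈ A, dt b d ≠ dt a d → b + (a' - a) ∈ A := by
    intro b hb hbd
    have hinj : ∀ x ∈ A.filter (fun y => dt y d = dt b d), ∀ y ∈ A.filter (fun y => dt y d = dt b d),
        dt x (cr v z) = dt y (cr v z) → x = y := by
      intro x hx y hy hxy
      rw [mem_filter] at hx hy
      apply (sA y hy.1).2 x hx.1
      obtain ⟨t, ht⟩ := par_of_perp (d := d) (e := cr v z) (u := x - y) (by rw [cre]; exact hv)
        (by rw [dt_comm, sub_dt, hx.2, hy.2, sub_self])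
        (by rw [dt_comm, sub_dt, hxy, sub_self])
      rw [ht, cre, cr_smul, cr_self, smul_zero]
    obtain ⟨b', hb', hbe⟩ := surj_of_inj _ _ (by rw [(sA b hb).1]) hinj
      (dt b (cr v z) + dt (a' - a) (cr v z))
    rw [mem_filter] at hb'
    obtain ⟨κ, hκ⟩ := par_of_perp (d := d) (e := cr v z) (u := b' - b - (a' - a))
        (by rw [cre]; exact hv)
        (by rw [dt_sub, hdh, dt_comm, sub_dt, hb'.2]; ring)
        (by rw [dt_comm, sub_dt, sub_dt, hbe]; ring)
    rw [cre] at hκ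
    by_cases hk : κ = 0
    · rw [hk, zero_smul, sub_eq_zero] at hκ
      rw [← hκ]; simpa using hb'.1
    exfalso
    have hab : a ≠ b := by rintro rfl; exact hbd rfl
    have hab' : a' ≠ b' := by rintro rfl; exact hbd (hb'.2.symm.trans ha'.2)
    have B1 := h.bE b hb a ha hab.symm
    have B2 := h.bE b' hb'.1 a' ha'.1 hab'.symm
    have hu2 : b' - a' = (b - a) + κ • v := by rw [← hκ]; abel
    have split : ∀ u c, (E.filter fun x => dt x u = c).card =
        (E.filter fun x => dt x v = dt x1 v ∧ dt x u = c).card +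
        (E.filter fun x => dt x v = dt x2 v ∧ dt x u = c).card := by
      intro u c
      rw [← card_union_of_disjoint]
      · congr 1
        ext y
        simp only [mem_union, mem_filter]
        constructor
        · rintro ⟨h1, h2⟩
          rcases clsE y h1 with h3 | h3 <;> tauto
        · tauto
      · rw [disjoint_filter]
        rintro x _ ⟨h3, _⟩ ⟨h4, _⟩
        exact hx12 (h4.symm.trans h3)
    have sh : ∀ c c', (E.filter fun x => dt x v = c ∧ dt x (b' - a') = c').card =
        (E.filter fun x => dt x v = c ∧ dt x (b - a) = c' - κ * c).card := by
      intro c c'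
      congr 1
      apply filter_congr
      intro x _
      rw [hu2, dt_add, dt_smul]
      constructor
      · rintro ⟨h1, h2⟩; exact ⟨h1, by rw [← h2, h1]; ring⟩
      · rintro ⟨h1, h2⟩; exact ⟨h1, by rw [h2, h1]; ring⟩
    have per : ∀ c, (fun c => (E.filter fun x => dt x v = dt x1 v ∧ dt x (b - a) = c).card) c =
        (fun c => (E.filter fun x => dt x v = dt x1 v ∧ dt x (b - a) = c).card)
          (c + κ * (dt x1 v - dt x2 v)) := by
      intro c
      have e1 := B2 (c + κ * dt x1 v)
      rw [split, sh, sh] at e1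
      have e2 := B1 (c + κ * (dt x1 v - dt x2 v))
      rw [split] at e2
      have e3 : c + κ * dt x1 v - κ * dt x1 v = c := by ring
      have e4 : c + κ * dt x1 v - κ * dt x2 v = c + κ * (dt x1 v - dt x2 v) := by ring
      rw [e3, e4] at e1
      show (E.filter fun x => dt x v = dt x1 v ∧ dt x (b - a) = c).card = (E.filter fun x => dt x v = dt x1 v ∧ dt x (b - a) = c + κ * (dt x1 v - dt x2 v)).card
      omega
    have con := periodic_const (mul_ne_zero hk (sub_ne_zero.mpr (Ne.symm hx12))) per
    have n1 : ∀ c, (E.filter fun x => dt x v = dt x1 v ∧ dt x (b - a) = c).card = 1 := by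
      have s := fib_sum (E.filter fun x => dt x v = dt x1 v) (fun x => dt x (b - a))
      simp only [filter_filter] at s
      rw [(sE x1 hx1).1, sum_congr rfl (fun c _ => con c), sum_const, card_univ, ZMod.card,
        smul_eq_mul] at s
      intro c
      have := con c
      beta_reduce at this s
      rw [this]
      omega
    have n2 : ∀ c, (E.filter fun x => dt x v = dt x2 v ∧ dt x (b - a) = c).card = 1 := by
      intro c
      have e2 := B1 c
      rw [split, n1 c] at e2
      omega
    have hcr : cr d (cr (b - a) v) ≠ 0 := by
      rw [cr_cr, dv', zero_smul, zero_sub, neg_ne_zero]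
      apply smul_ne_zero _ hv
      rw [dt_comm, sub_dt, sub_ne_zero]
      exact hbd
    obtain ⟨_, x, hx, y, hy, hxy, hc⟩ := clE (cr (b - a) v) (dt_cr_right _ _) hcr
    have hw0 : cr (b - a) v ≠ 0 := by intro h0; rw [h0, cr_zero] at hcr; exact hcr rfl
    obtain ⟨t, ht⟩ := par_smul hw0 hc
    have f1 : dt x v = dt y v := by
      rw [← sub_eq_zero, ← sub_dt, ht, smul_dt, cr_dt_right, mul_zero]
    have f2 : dt x (b - a) = dt y (b - a) := by
      rw [← sub_eq_zero, ← sub_dt, ht, smul_dt, cr_dt_left, mul_zero]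
    have : (E.filter fun x => dt x v = dt y v ∧ dt x (b - a) = dt y (b - a)).card = 1 := by
      rcases clsE y hy with h3 | h3
      · rw [h3]; exact n1 _
      · rw [h3]; exact n2 _
    rw [card_eq_one] at this
    obtain ⟨g, hg⟩ := this
    have gx : x ∈ ({g} : Finset V3) := by rw [← hg]; simp [hx, f1, f2]
    have gy : y ∈ ({g} : Finset V3) := by rw [← hg]; simp [hy]
    rw [mem_singleton] at gx gy
    exact hxy (gx.trans gy.symm)
  have k1 := step a2 ha2 haa
  have dd : ∀ y, dt (y + (a' - a)) d = dt y d := by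
    intro y; rw [add_dt, dt_comm (a' - a), hdh, add_zero]
  have k2 := step _ k1 (by rw [dd]; exact haa)
  have hcap := h.symm.cap (u := d) (v := cr (a' - a) z) (by rw [cr_cr, hz, hdh]; simpa using hh0)
    (dt a2 d) (dt a2 (cr (a' - a) z))
  have d1 : ∀ y : V3, y + (a' - a) ≠ y := by
    intro y; rw [Ne, add_eq_left]; exact hh0
  have d2 : a2 + (a' - a) + (a' - a) ≠ a2 := by
    intro h0
    have : (2 : ZMod 7) • (a' - a) = 0 := by
      rw [two_smul]; rw [add_assoc, add_eq_left] at h0; exact h0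
    rcases smul_eq_zero.mp this with h1 | h1
    · exact absurd h1 (by decide)
    · exact hh0 h1
  have hsub : ({a2, a2 + (a' - a), a2 + (a' - a) + (a' - a)} : Finset V3) ⊆
      A.filter fun x => dt x d = dt a2 d ∧ dt x (cr (a' - a) z) = dt a2 (cr (a' - a) z) := by
    have dz : ∀ y, dt (y + (a' - a)) (cr (a' - a) z) = dt y (cr (a' - a) z) := by
      intro y; rw [add_dt, dt_cr_left, add_zero]
    intro y hy
    simp only [mem_insert, mem_singleton] at hy
    rw [mem_filter]
    rcases hy with rfl | rfl | rfl
    · exact ⟨ha2, rfl, rfl⟩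
    · exact ⟨k1, dd _, dz _⟩
    · exact ⟨k2, by rw [dd, dd], by rw [dz, dz]⟩
  have := card_le_card hsub
  rw [card_eq_three.mpr ⟨a2, _, _, (d1 _).symm, d2.symm, (d1 _).symm, rfl⟩] at this
  omega

def Form (k : ℕ) (f : V3 → ZMod 7) : Prop :=
  (∀ (c : ZMod 7) u, f (c • u) = c ^ k * f u) ∧
  ∀ p q, ∃ a : ℕ → ZMod 7, a k = f q ∧
    ∀ t : ZMod 7, f (p + t • q) = ∑ i ∈ range (k + 1), a i * t ^ i

theorem span2 {p q u : V3} (h : cr p q ≠ 0) (hu : dt u (cr p q) = 0) :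
    ∃ s t : ZMod 7, u = s • p + t • q := by
  obtain ⟨z, hz⟩ := exists_dt_one h
  refine ⟨dt u (cr q z), dt u (cr z p), ?_⟩
  have key : dt (cr p q) z • u =
      dt u (cr q z) • p + dt u (cr z p) • q + dt u (cr p q) • z := by
    ext i; fin_cases i <;> simp [cr, dt] <;> ring
  rw [hz, hu, one_smul, zero_smul, add_zero] at key
  exact key

theorem exists_perp_nonpar {d v : V3} (d0 : d ≠ 0) (hv : v ≠ 0) : ∃ g, dt d g = 0 ∧ cr v g ≠ 0 := by
  by_contra hh
  push Not at hh
  have c1 : (univ.filter fun u : V3 => dt d u = 0) ⊆ univ.filter fun u : V3 => cr v u = 0 := by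
    intro u hu
    simp only [mem_filter, mem_univ, true_and] at hu ⊢
    exact hh u hu
  have := card_le_card c1
  rw [card_perp d0, card_par hv] at this
  omega

theorem card_units7 : (univ.erase (0 : ZMod 7)).card = 6 := by
  rw [card_erase_of_mem (mem_univ _), card_univ, ZMod.card]

theorem Form.card_le {k : ℕ} {f : V3 → ZMod 7} (hf : Form k f) (hk : k ≠ 0) {d q : V3} (hd : d ≠ 0)
    (hq : dt d q = 0) (hfq : f q ≠ 0) :
    ((univ.filter fun u : V3 => u ≠ 0 ∧ f u = 0).filter fun u => dt d u = 0).card ≤ 6 * k := by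
  have f0 : f 0 = 0 := by
    have := hf.1 0 0
    rw [zero_pow hk, zero_mul, smul_zero] at this
    exact this
  have q0 : q ≠ 0 := by rintro rfl; exact hfq f0
  obtain ⟨p, hp, hqp⟩ := exists_perp_nonpar hd q0
  have hpq : cr p q ≠ 0 := fun h => hqp (cr_eq_zero_comm.mp h)
  obtain ⟨a, ha, hG⟩ := hf.2 p q
  set G : Polynomial (ZMod 7) := ∑ i ∈ range (k + 1), Polynomial.monomial i (a i) with hGd
  have hGe : ∀ t, G.eval t = f (p + t • q) := by
    intro t
    rw [hG, hGd, Polynomial.eval_finsetSum]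
    simp [Polynomial.eval_monomial]
  have hdeg : G.natDegree ≤ k := by
    apply Polynomial.natDegree_sum_le_of_forall_le
    intro i hi
    rw [mem_range] at hi
    exact (Polynomial.natDegree_monomial_le _).trans (by omega)
  have hG0 : G ≠ 0 := by
    intro h
    have : G.coeff k = a k := by
      rw [hGd, Polynomial.finsetSum_coeff, sum_eq_single k]
      · simp
      · intro b _ hb; rw [Polynomial.coeff_monomial, if_neg hb]
      · intro h; simp at h
    rw [h, Polynomial.coeff_zero] at this
    exact hfq (ha ▸ this.symm)
  have hsub : ((univ.filter fun u : V3 => u ≠ 0 ∧ f u = 0).filter fun u => dt d u = 0) ⊆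
      ((univ.erase (0 : ZMod 7)) ×ˢ G.roots.toFinset).image fun z => z.1 • (p + z.2 • q) := by
    intro u hu
    simp only [mem_filter, mem_univ, true_and] at hu
    obtain ⟨⟨u0, hfu⟩, hdu⟩ := hu
    obtain ⟨r, hr⟩ := par_of_perp (u := d) hpq (by rw [dt_comm]; exact hp) (by rw [dt_comm]; exact hq)
    have r0 : r ≠ 0 := by rintro rfl; rw [zero_smul] at hr; exact hd hr
    have hun : dt u (cr p q) = 0 := by
      rw [hr, smul_dt] at hdu
      rw [dt_comm]
      exact (mul_eq_zero.mp hdu).resolve_left r0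
    obtain ⟨s, t, hst⟩ := span2 hpq hun
    have s0 : s ≠ 0 := by
      rintro rfl
      rw [zero_smul, zero_add] at hst
      rw [hst, hf.1] at hfu
      have t0 : t ≠ 0 := by rintro rfl; rw [zero_smul] at hst; exact u0 hst
      exact mul_ne_zero (pow_ne_zero _ t0) hfq hfu
    have hu' : u = s • (p + (t / s) • q) := by
      rw [smul_add, smul_smul, mul_div_cancel₀ _ s0, hst]
    rw [mem_image]
    refine ⟨(s, t / s), ?_, hu'.symm⟩
    simp only [mem_product, mem_erase, mem_univ, and_true, Multiset.mem_toFinset]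
    refine ⟨s0, ?_⟩
    rw [Polynomial.mem_roots hG0, Polynomial.IsRoot, hGe]
    rw [hu', hf.1] at hfu
    exact (mul_eq_zero.mp hfu).resolve_left (pow_ne_zero _ s0)
  refine (card_le_card hsub).trans (card_image_le.trans ?_)
  rw [card_product, card_units7]
  apply Nat.mul_le_mul_left
  exact (Multiset.toFinset_card_le _).trans ((Polynomial.card_roots' G).trans hdeg)

theorem Form_pow (E : Finset V3) (k : ℕ) : Form k fun u => ∑ x ∈ E, (dt x u) ^ k := by
  constructor
  · intro c u
    rw [mul_sum]
    apply sum_congr rfl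
    intro x _
    rw [dt_smul, mul_pow]
  · intro p q
    refine ⟨fun i => ∑ x ∈ E, (dt x q) ^ i * (dt x p) ^ (k - i) * (k.choose i : ZMod 7), ?_, ?_⟩
    · simp
    · intro t
      simp only [sum_mul]
      rw [sum_comm]
      apply sum_congr rfl
      intro x _
      rw [dt_add, dt_smul, add_comm, add_pow]
      apply sum_congr rfl
      intro i _
      rw [mul_pow]; ring

theorem Form_cubic (E : Finset V3) (α β γ : V3 → V3) :
    Form 3 fun u => ∑ x ∈ E, dt (α x) u * dt (β x) u * dt (γ x) u := by
  constructor
  · intro c u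
    rw [mul_sum]
    apply sum_congr rfl
    intro x _
    simp only [dt_smul]; ring
  · intro p q
    refine ⟨fun i => ∑ x ∈ E, if i = 0 then dt (α x) p * dt (β x) p * dt (γ x) p else
      if i = 1 then dt (α x) q * dt (β x) p * dt (γ x) p + dt (α x) p * dt (β x) q * dt (γ x) p
        + dt (α x) p * dt (β x) p * dt (γ x) q else
      if i = 2 then dt (α x) q * dt (β x) q * dt (γ x) p + dt (α x) p * dt (β x) q * dt (γ x) q
        + dt (α x) q * dt (β x) p * dt (γ x) q else dt (α x) q * dt (β x) q * dt (γ x) q, ?_, ?_⟩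
    · simp
    · intro t
      simp only [sum_mul]
      rw [sum_comm]
      apply sum_congr rfl
      intro x _
      simp [sum_range_succ, dt_add, dt_smul]
      ring

theorem cubic_factor (E : Finset V3) (α β γ : V3 → V3) {d0 d1 : V3} (hd : cr d0 d1 ≠ 0)
    (h0 : ∀ u, dt d0 u = 0 → ∑ x ∈ E, dt (α x) u * dt (β x) u * dt (γ x) u = 0)
    (h1 : ∀ u, dt d1 u = 0 → ∑ x ∈ E, dt (α x) u * dt (β x) u * dt (γ x) u = 0) :
    ∃ e, ∀ u, ∑ x ∈ E, dt (α x) u * dt (β x) u * dt (γ x) u = dt d0 u * dt d1 u * dt e u := by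
  obtain ⟨e3, he⟩ := exists_dt_one hd
  have hδ : dt d0 (cr d1 e3) = 1 := by rw [dt_cr_cyc, dt_cr_cyc, dt_comm, he]
  have exp : ∀ p q o : V3, ∃ a1 a2 a3 a4 a5 a6 a7 a8 a9 a10 : ZMod 7, ∀ s t r : ZMod 7,
      ∑ x ∈ E, dt (α x) (s • p + t • q + r • o) * dt (β x) (s • p + t • q + r • o)
        * dt (γ x) (s • p + t • q + r • o) =
      a1 * s ^ 3 + a2 * t ^ 3 + a3 * r ^ 3 + a4 * (s ^ 2 * t) + a5 * (s * t ^ 2) + a6 * (s ^ 2 * r)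
      + a7 * (s * r ^ 2) + a8 * (t ^ 2 * r) + a9 * (t * r ^ 2) + a10 * (s * t * r) := by
    intro p q o
    refine ⟨∑ x ∈ E, dt (α x) p * dt (β x) p * dt (γ x) p,
      ∑ x ∈ E, dt (α x) q * dt (β x) q * dt (γ x) q,
      ∑ x ∈ E, dt (α x) o * dt (β x) o * dt (γ x) o,
      ∑ x ∈ E, (dt (α x) p * dt (β x) p * dt (γ x) q + dt (α x) p * dt (β x) q * dt (γ x) p +
        dt (α x) q * dt (β x) p * dt (γ x) p),
      ∑ x ∈ E, (dt (α x) q * dt (β x) q * dt (γ x) p + dt (α x) q * dt (β x) p * dt (γ x) q +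
        dt (α x) p * dt (β x) q * dt (γ x) q),
      ∑ x ∈ E, (dt (α x) p * dt (β x) p * dt (γ x) o + dt (α x) p * dt (β x) o * dt (γ x) p +
        dt (α x) o * dt (β x) p * dt (γ x) p),
      ∑ x ∈ E, (dt (α x) o * dt (β x) o * dt (γ x) p + dt (α x) o * dt (β x) p * dt (γ x) o +
        dt (α x) p * dt (β x) o * dt (γ x) o),
      ∑ x ∈ E, (dt (α x) q * dt (β x) q * dt (γ x) o + dt (α x) q * dt (β x) o * dt (γ x) q +
        dt (α x) o * dt (β x) q * dt (γ x) q),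
      ∑ x ∈ E, (dt (α x) o * dt (β x) o * dt (γ x) q + dt (α x) o * dt (β x) q * dt (γ x) o +
        dt (α x) q * dt (β x) o * dt (γ x) o),
      ∑ x ∈ E, (dt (α x) p * dt (β x) q * dt (γ x) o + dt (α x) p * dt (β x) o * dt (γ x) q +
        dt (α x) q * dt (β x) p * dt (γ x) o + dt (α x) q * dt (β x) o * dt (γ x) p +
        dt (α x) o * dt (β x) p * dt (γ x) q + dt (α x) o * dt (β x) q * dt (γ x) p), ?_⟩
    intro s t r
    simp only [sum_mul, ← sum_add_distrib, dt_add, dt_smul]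
    apply sum_congr rfl
    intro x _
    ring
  obtain ⟨a1, a2, a3, a4, a5, a6, a7, a8, a9, a10, hexp⟩ := exp (cr d1 e3) (cr e3 d0) (cr d0 d1)
  have z0 : ∀ t r : ZMod 7, a2 * t ^ 3 + a3 * r ^ 3 + a8 * (t ^ 2 * r) + a9 * (t * r ^ 2) = 0 := by
    intro t r
    have := hexp 0 t r
    rw [h0] at this
    · linear_combination -this
    · simp only [dt_add, dt_smul, dt_cr_left, dt_cr_right]; ring
  have z1 : ∀ s r : ZMod 7, a1 * s ^ 3 + a3 * r ^ 3 + a6 * (s ^ 2 * r) + a7 * (s * r ^ 2) = 0 := by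
    intro s r
    have := hexp s 0 r
    rw [h1] at this
    · linear_combination -this
    · simp only [dt_add, dt_smul, dt_cr_left, dt_cr_right]; ring
  have h4 : (4 : ZMod 7) * 2 = 1 := by decide
  have b2 : a2 = 0 := by linear_combination z0 1 0
  have b3 : a3 = 0 := by linear_combination z0 0 1
  have b1 : a1 = 0 := by linear_combination z1 1 0
  have b9 : a9 = 0 := by
    linear_combination 4 * (z0 1 1 + z0 1 (-1)) - 8 * b2 - h4 * a9
  have b8 : a8 = 0 := by linear_combination z0 1 1 - b2 - b3 - b9
  have b7 : a7 = 0 := by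
    linear_combination 4 * (z1 1 1 + z1 1 (-1)) - 8 * b1 - h4 * a7
  have b6 : a6 = 0 := by linear_combination z1 1 1 - b1 - b3 - b7
  refine ⟨a4 • d0 + a5 • d1 + a10 • e3, fun u => ?_⟩
  have hu := dt_expand d0 d1 e3 u
  rw [hδ, one_smul] at hu
  have := hexp (dt d0 u) (dt d1 u) (dt e3 u)
  rw [← hu] at this
  rw [this, add_dt, add_dt, smul_dt, smul_dt, smul_dt, b1, b2, b3, b6, b7, b8, b9]
  ring

/-- counting -/
theorem sum_k {ι : Type*} (I : Finset ι) (φ : ι → V3) (hφ : ∀ i ∈ I, φ i ≠ 0) :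
    ∑ d ∈ univ.erase (0 : V3), (I.filter fun i => dt d (φ i) = 0).card = 48 * I.card := by
  rw [dc, sum_congr rfl (g := fun _ => 48), sum_const, smul_eq_mul, mul_comm]
  intro i hi
  refine Eq.trans ?_ (card_perp_ne (hφ i hi))
  congr 1
  ext d
  simp [dt_comm d]

theorem sum_k2 {ι : Type*} (I : Finset ι) (φ : ι → V3) (hφ : ∀ i ∈ I, φ i ≠ 0) :
    ∑ d ∈ univ.erase (0 : V3), (I.filter fun i => dt d (φ i) = 0).card ^ 2 =
      6 * I.card ^ 2 + 42 * ((I ×ˢ I).filter fun p => cr (φ p.1) (φ p.2) = 0).card := by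
  have h1 : ∀ d ∈ univ.erase (0 : V3), (I.filter fun i => dt d (φ i) = 0).card ^ 2 =
      ((I ×ˢ I).filter fun p => dt d (φ p.1) = 0 ∧ dt d (φ p.2) = 0).card := by
    intro d _
    rw [sq, ← card_product, ← filter_product]
  rw [sum_congr rfl h1, dc]
  have h2 : ∀ p ∈ I ×ˢ I, ((univ.erase (0 : V3)).filter fun d =>
      dt d (φ p.1) = 0 ∧ dt d (φ p.2) = 0).card =
      6 + 42 * (if cr (φ p.1) (φ p.2) = 0 then 1 else 0) := by
    intro p hp
    rw [mem_product] at hp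
    split_ifs with hc
    · obtain ⟨t, ht⟩ := par_smul (hφ _ hp.1) hc
      refine Eq.trans ?_ (card_perp_ne (hφ _ hp.1))
      congr 1
      ext d
      simp only [mem_filter, mem_erase, mem_univ, and_true, true_and]
      rw [ht, dt_smul, dt_comm d]
      constructor
      · rintro ⟨h1, h2, h3⟩; exact ⟨h1, h2⟩
      · rintro ⟨h1, h2⟩; exact ⟨h1, h2, by rw [h2, mul_zero]⟩
    · refine Eq.trans ?_ (card_perp2_ne hc)
      congr 1
      ext d
      simp [dt_comm d]
  rw [sum_congr rfl h2, sum_add_distrib, sum_const, card_product, smul_eq_mul, ← mul_sum,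
    ← card_filter]
  ring

def Cone (S : Finset V3) : Prop := (∀ u ∈ S, u ≠ 0) ∧ ∀ u ∈ S, ∀ t : ZMod 7, t ≠ 0 → t • u ∈ S

theorem Cone.par {S : Finset V3} (hS : Cone S) {u : V3} (hu : u ∈ S) :
    (S.filter fun w => cr u w = 0).card = 6 := by
  have : (S.filter fun w => cr u w = 0) = (univ.filter fun w : V3 => cr u w = 0).erase 0 := by
    ext w
    simp only [mem_filter, mem_erase, mem_univ, true_and]
    constructor
    · rintro ⟨h1, h2⟩; exact ⟨hS.1 w h1, h2⟩
    · rintro ⟨h1, h2⟩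
      refine ⟨?_, h2⟩
      obtain ⟨t, rfl⟩ := par_smul (hS.1 u hu) h2
      apply hS.2 u hu
      rintro rfl
      simp at h1
  rw [this, card_erase_of_mem (by simp [cr_zero]), card_par (hS.1 u hu)]

theorem Cone.sum1 {S : Finset V3} (hS : Cone S) :
    ∑ d ∈ univ.erase (0 : V3), (S.filter fun u => dt d u = 0).card = 48 * S.card :=
  sum_k S (fun u => u) hS.1

theorem Cone.sum2 {S : Finset V3} (hS : Cone S) :
    ∑ d ∈ univ.erase (0 : V3), (S.filter fun u => dt d u = 0).card ^ 2 =
      6 * S.card ^ 2 + 252 * S.card := by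
  rw [sum_k2 S (fun u => u) hS.1]
  have : ((S ×ˢ S).filter fun p => cr p.1 p.2 = 0).card = 6 * S.card := by
    rw [card_filter, sum_product, sum_congr rfl (g := fun _ => 6), sum_const, smul_eq_mul, mul_comm]
    intro u hu
    rw [← card_filter]
    exact hS.par hu
  rw [this]; ring

theorem Cone.ineq {S : Finset V3} (hS : Cone S) (lo hi : ℕ)
    (h : ∀ d, d ≠ 0 → lo ≤ (S.filter fun u => dt d u = 0).card ∧
      (S.filter fun u => dt d u = 0).card ≤ hi) :
    6 * S.card ^ 2 + 252 * S.card + lo * hi * 342 ≤ (lo + hi) * (48 * S.card) := by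
  rw [← hS.sum2, ← hS.sum1, mul_sum]
  have : (univ.erase (0 : V3)).card = 342 := by
    rw [card_erase_of_mem (mem_univ _), card_V3]
  have h2 : lo * hi * 342 = ∑ d ∈ univ.erase (0 : V3), lo * hi := by
    rw [sum_const, this, smul_eq_mul, mul_comm]
  rw [h2, ← sum_add_distrib]
  apply sum_le_sum
  intro d hd
  obtain ⟨h3, h4⟩ := h d (ne_of_mem_erase hd)
  generalize (S.filter fun u => dt d u = 0).card = k at *
  obtain ⟨a, rfl⟩ := Nat.exists_eq_add_of_le h3
  obtain ⟨b, rfl⟩ := Nat.exists_eq_add_of_le h4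
  nlinarith [Nat.zero_le (a * b)]

theorem Cone.pt {S : Finset V3} (hS : Cone S) {d u : V3} (hu : u ∈ S) (hd : dt d u = 0) :
    6 ≤ (S.filter fun u => dt d u = 0).card := by
  rw [← hS.par hu]
  apply card_le_card
  intro w hw
  rw [mem_filter] at hw ⊢
  obtain ⟨t, rfl⟩ := par_smul (hS.1 u hu) hw.2
  exact ⟨hw.1, by rw [dt_smul, hd, mul_zero]⟩

theorem Cone.through {S : Finset V3} (hS : Cone S) {u : V3} (hu : u ∈ S) :
    ∑ d ∈ univ.filter (fun d : V3 => d ≠ 0 ∧ dt u d = 0), (S.filter fun w => dt d w = 0).card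
      = 6 * S.card + 252 := by
  rw [dc]
  have h2 : ∀ w ∈ S, ((univ.filter (fun d : V3 => d ≠ 0 ∧ dt u d = 0)).filter
      fun d => dt d w = 0).card = 6 + 42 * (if cr u w = 0 then 1 else 0) := by
    intro w hw
    rw [filter_filter]
    split_ifs with hc
    · obtain ⟨t, ht⟩ := par_smul (hS.1 u hu) hc
      refine Eq.trans ?_ (card_perp_ne (hS.1 u hu))
      congr 1
      ext d
      simp only [mem_filter, mem_univ, true_and]
      rw [ht, dt_smul, dt_comm d]
      constructor
      · rintro ⟨⟨h1, h2⟩, h3⟩; exact ⟨h1, h2⟩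
      · rintro ⟨h1, h2⟩; exact ⟨⟨h1, h2⟩, by rw [h2, mul_zero]⟩
    · refine Eq.trans ?_ (card_perp2_ne hc)
      congr 1
      ext d
      simp [dt_comm d, and_assoc]
  rw [sum_congr rfl h2, sum_add_distrib, sum_const, smul_eq_mul, ← mul_sum, ← card_filter,
    hS.par hu]
  ring

theorem SP.three_aux {E A : Finset V3} (h : SP E A) {l1 l2 l3 : V3} (h12 : cr l1 l2 ≠ 0)
    (h13 : cr l1 l3 ≠ 0) (h23 : cr l2 l3 ≠ 0)
    (hall : ∀ x ∈ E, ∀ y ∈ E, x ≠ y → dt x l1 = dt y l1 ∨ dt x l2 = dt y l2 ∨ dt x l3 = dt y l3)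
    {p q : V3} (hp : p ∈ E) (hq : q ∈ E) (hpq : p ≠ q) (e1 : dt p l1 = dt q l1)
    (e2 : dt p l2 ≠ dt q l2) : dt p l3 = dt q l3 := by
  by_contra e3
  have l10 : l1 ≠ 0 := by rintro rfl; exact h12 (zero_cr _)
  obtain ⟨r, hr, hr1⟩ := h.noplane l10 (dt p l1)
  have s1 : E ⊆ ((E.filter fun x => dt x l2 = dt p l2 ∧ dt x l3 = dt q l3) ∪
      (E.filter fun x => dt x l2 = dt q l2 ∧ dt x l3 = dt p l3)) ∪
      ((E.filter fun x => dt x l1 = dt p l1 ∧ dt x l2 = dt r l2) ∪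
      (E.filter fun x => dt x l1 = dt p l1 ∧ dt x l3 = dt r l3)) := by
    intro x hx
    simp only [mem_union, mem_filter, hx, true_and]
    by_cases hx1 : dt x l1 = dt p l1
    · right
      have hne : x ≠ r := by rintro rfl; exact hr1 hx1
      rcases hall x hx r hr hne with h | h | h
      · exact absurd (h.symm.trans hx1) hr1
      · exact Or.inl ⟨hx1, h⟩
      · exact Or.inr ⟨hx1, h⟩
    · left
      have hne : x ≠ p := by rintro rfl; exact hx1 rfl
      have hne' : x ≠ q := by rintro rfl; exact hx1 e1.symm
      rcases hall x hx p hp hne with h | h | h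
      · exact absurd h hx1
      · rcases hall x hx q hq hne' with h' | h' | h'
        · exact absurd (h'.trans e1.symm) hx1
        · exact absurd (h.symm.trans h') e2
        · exact Or.inl ⟨h, h'⟩
      · rcases hall x hx q hq hne' with h' | h' | h'
        · exact absurd (h'.trans e1.symm) hx1
        · exact Or.inr ⟨h', h⟩
        · exact absurd (h.symm.trans h') e3
  have c1 := (card_le_card s1).trans ((card_union_le _ _).trans
    (Nat.add_le_add (card_union_le _ _) (card_union_le _ _)))
  have := h.cap h23 (dt p l2) (dt q l3)
  have := h.cap h23 (dt q l2) (dt p l3)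
  have := h.cap h12 (dt p l1) (dt r l2)
  have := h.cap h13 (dt p l1) (dt r l3)
  have := h.cE
  omega

theorem prop_aux {P Q R : Prop} (k1 : P ∨ Q ∨ R) (k2 : P → ¬ Q → R) (k3 : Q → ¬ P → R)
    (k4 : R → ¬ Q → P) : (P ∧ Q) ∨ (P ∧ R) ∨ (Q ∧ R) := by
  tauto

theorem SP.three {E A : Finset V3} (h : SP E A) {l1 l2 l3 : V3} (h12 : cr l1 l2 ≠ 0)
    (h13 : cr l1 l3 ≠ 0) (h23 : cr l2 l3 ≠ 0)
    (hall : ∀ x ∈ E, ∀ y ∈ E, x ≠ y → dt x l1 = dt y l1 ∨ dt x l2 = dt y l2 ∨ dt x l3 = dt y l3) :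
    False := by
  obtain ⟨p, hp⟩ : E.Nonempty := by rw [← card_pos, h.cE]; norm_num
  have h21 : cr l2 l1 ≠ 0 := fun h => h12 (cr_eq_zero_comm.mp h)
  have h31 : cr l3 l1 ≠ 0 := fun h => h13 (cr_eq_zero_comm.mp h)
  have h32 : cr l3 l2 ≠ 0 := fun h => h23 (cr_eq_zero_comm.mp h)
  have s1 : E ⊆ (E.filter fun x => dt x l1 = dt p l1 ∧ dt x l2 = dt p l2) ∪
      ((E.filter fun x => dt x l1 = dt p l1 ∧ dt x l3 = dt p l3) ∪
      (E.filter fun x => dt x l2 = dt p l2 ∧ dt x l3 = dt p l3)) := by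
    intro x hx
    simp only [mem_union, mem_filter, hx, true_and]
    by_cases hne : x = p
    · left; rw [hne]; exact ⟨rfl, rfl⟩
    have k1 := hall x hx p hp hne
    have k2 := h.three_aux h12 h13 h23 hall hx hp hne
    have k3 := h.three_aux h21 h23 h13 (fun x hx y hy hxy => (or_left_comm.mp (hall x hx y hy hxy))) hx hp hne
    have k4 := h.three_aux h32 h31 h21 (fun x hx y hy hxy => by
      rcases hall x hx y hy hxy with h1 | h1 | h1
      · exact Or.inr (Or.inr h1)
      · exact Or.inr (Or.inl h1)
      · exact Or.inl h1) hx hp hne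
    exact prop_aux k1 k2 k3 k4
  have c1 := (card_le_card s1).trans ((card_union_le _ _).trans
    (Nat.add_le_add_left (card_union_le _ _) _))
  have := h.cap h12 (dt p l1) (dt p l2)
  have := h.cap h13 (dt p l1) (dt p l3)
  have := h.cap h23 (dt p l2) (dt p l3)
  have := h.cE
  omega

theorem Dir.smul {A : Finset V3} {u : V3} (h : Dir A u) {t : ZMod 7} (ht : t ≠ 0) :
    Dir A (t • u) := by
  obtain ⟨h0, a, ha, b, hb, hab, hc⟩ := h
  exact ⟨smul_ne_zero ht h0, a, ha, b, hb, hab, by rw [smul_cr, hc, smul_zero]⟩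

theorem Dir.of_sub {A : Finset V3} {a b : V3} (ha : a ∈ A) (hb : b ∈ A) (hab : a ≠ b) :
    Dir A (a - b) := ⟨sub_ne_zero.mpr hab, a, ha, b, hb, hab, cr_self _⟩

/-- block a line by an affine direction -/
theorem SP.block_line {E A : Finset V3} (h : SP E A) {g w : V3} (hg : ¬ Dir A g) (_g0 : g ≠ 0)
    (hgw : cr g w ≠ 0) : ∃ t : ZMod 7, Dir A (w + t • g) := by
  obtain ⟨a, ha, b, hb, hab, he⟩ := h.blocking (cr g w)
  obtain ⟨t, s, hst⟩ := span2 hgw (by rw [dt_comm]; exact he)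
  have hD := Dir.of_sub ha hb hab
  have s0 : s ≠ 0 := by
    rintro rfl
    rw [zero_smul, add_zero] at hst
    have t0 : t ≠ 0 := by
      rintro rfl; rw [zero_smul] at hst; exact hD.1 hst
    apply hg
    have := hD.smul (inv_ne_zero t0)
    rwa [hst, smul_smul, inv_mul_cancel₀ t0, one_smul] at this
  refine ⟨t / s, ?_⟩
  have := hD.smul (inv_ne_zero s0)
  rw [hst, smul_add, smul_smul, smul_smul, inv_mul_cancel₀ s0, one_smul] at this
  rw [add_comm, div_eq_inv_mul]
  exact this

open Classical in
theorem aff_count {S : Finset V3} (hS : Cone S) {d0 g w : V3} (hg : g ∈ S) (hdg : dt d0 g = 0)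
    (hdw : dt d0 w = 1)
    (hk : ((S.filter fun u => dt (cr g w) u = 0).card ≤ 18)) (T : Finset (ZMod 7))
    (hT : ∀ t ∈ T, w + t • g ∈ S) : T.card ≤ 2 := by
  have g0 := hS.1 g hg
  have i1 : ((univ.erase (0 : ZMod 7)).image fun s => s • g).card = 6 := by
    rw [card_image_of_injective _ (fun s t hst => smul_inj g0 hst), card_units7]
  have i2 : (((univ.erase (0 : ZMod 7)) ×ˢ T).image fun z => z.1 • (w + z.2 • g)).card
      = 6 * T.card := by
    rw [card_image_of_injOn, card_product, card_units7]
    rintro ⟨s, t⟩ hz ⟨s', t'⟩ hz' heq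
    simp only [coe_product, Set.mem_prod, mem_coe, mem_erase, mem_univ, and_true] at hz hz'
    simp only at heq
    have e1 := congrArg (dt d0) heq
    simp only [dt_smul, dt_add, hdg, hdw, mul_zero, add_zero, mul_one] at e1
    subst e1
    have e2 := smul_right_injective V3 hz.1 heq
    have e3 := smul_inj g0 (add_left_cancel e2)
    rw [e3]
  have hdisj : Disjoint ((univ.erase (0 : ZMod 7)).image fun s => s • g)
      (((univ.erase (0 : ZMod 7)) ×ˢ T).image fun z => z.1 • (w + z.2 • g)) := by
    rw [disjoint_left]
    intro u h1 h2
    simp only [mem_image, mem_erase, mem_univ, and_true, mem_product, Prod.exists] at h1 h2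
    obtain ⟨s, hs, rfl⟩ := h1
    obtain ⟨s', t, ⟨hs', ht⟩, heq⟩ := h2
    have e1 := congrArg (dt d0) heq
    simp only [dt_smul, dt_add, hdg, hdw, mul_zero, add_zero, mul_one] at e1
    exact hs' e1
  have hsub : ((univ.erase (0 : ZMod 7)).image fun s => s • g) ∪
      (((univ.erase (0 : ZMod 7)) ×ˢ T).image fun z => z.1 • (w + z.2 • g)) ⊆
      S.filter fun u => dt (cr g w) u = 0 := by
    intro u hu
    rw [mem_union] at hu
    simp only [mem_image, mem_erase, mem_univ, and_true, mem_product, Prod.exists] at hu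
    rw [mem_filter]
    rcases hu with ⟨s, hs, rfl⟩ | ⟨s, t, ⟨hs, ht⟩, rfl⟩
    · exact ⟨hS.2 g hg s hs, by rw [dt_smul, cr_dt_left, mul_zero]⟩
    · exact ⟨hS.2 _ (hT t ht) s hs, by
        rw [dt_smul, dt_add, dt_smul, cr_dt_left, cr_dt_right]; ring⟩
  have := card_le_card hsub
  rw [card_union_of_disjoint hdisj, i1, i2] at this
  omega

open Classical in
theorem SP.lemmaX {E A : Finset V3} (h : SP E A) (F : Finset V3) (α β γ : V3 → V3)
    (hf : ∀ u, Dir A u → ∑ x ∈ F, dt (α x) u * dt (β x) u * dt (γ x) u = 0) (u0 : V3) :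
    ∑ x ∈ F, dt (α x) u0 * dt (β x) u0 * dt (γ x) u0 = 0 := by
  by_contra hu0
  have hform := Form_cubic F α β γ
  have hfac := @cubic_factor F α β γ
  obtain ⟨f, hfe⟩ : ∃ f : V3 → ZMod 7, f = fun u => ∑ x ∈ F, dt (α x) u * dt (β x) u * dt (γ x) u :=
    ⟨_, rfl⟩
  rw [← hfe] at hform
  have hfe' : ∀ u, ∑ x ∈ F, dt (α x) u * dt (β x) u * dt (γ x) u = f u := fun u => by rw [hfe]
  simp only [hfe'] at hf hu0 hfac
  clear hfe' hfe
  have f0 : f 0 = 0 := by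
    have := hform.1 0 0
    simpa using this
  obtain ⟨S, hSd⟩ : ∃ S, S = univ.filter fun u : V3 => u ≠ 0 ∧ f u = 0 := ⟨_, rfl⟩
  have memS : ∀ u, u ∈ S ↔ u ≠ 0 ∧ f u = 0 := by intro u; rw [hSd]; simp
  have hS : Cone S := by
    constructor
    · intro u hu; exact ((memS u).1 hu).1
    · intro u hu t ht
      rw [memS] at hu ⊢
      exact ⟨smul_ne_zero ht hu.1, by rw [hform.1, hu.2, mul_zero]⟩
  have hlo : ∀ d, 6 ≤ (S.filter fun u => dt d u = 0).card := by
    intro d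
    obtain ⟨a, ha, b, hb, hab, he⟩ := h.blocking d
    have hD := Dir.of_sub ha hb hab
    exact hS.pt ((memS _).2 ⟨hD.1, hf _ hD⟩) he
  have hhi : ∀ d, d ≠ 0 → (∃ q, dt d q = 0 ∧ f q ≠ 0) →
      (S.filter fun u => dt d u = 0).card ≤ 18 := by
    rintro d hd ⟨q, hq, hfq⟩
    rw [hSd]
    exact hform.card_le (by norm_num) hd hq hfq
  by_cases hpl : ∃ d0, d0 ≠ 0 ∧ ∀ q, dt d0 q = 0 → f q = 0
  swap
  · push Not at hpl
    have := hS.ineq 6 18 (fun d hd => ⟨hlo d, hhi d hd (hpl d hd)⟩)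
    have h2 : (6 * S.card ^ 2 + 252 * S.card + 6 * 18 * 342 : ℤ) ≤ (6 + 18) * (48 * S.card) := by
      exact_mod_cast this
    nlinarith [sq_nonneg ((S.card : ℤ) - 75)]
  obtain ⟨d0, hd0, hz0⟩ := hpl
  by_cases hal : ∃ d1, cr d0 d1 ≠ 0 ∧ ∀ q, dt d1 q = 0 → f q = 0
  · obtain ⟨d1, hd1, hz1⟩ := hal
    obtain ⟨e, he⟩ := hfac hd1 hz0 hz1
    have e0 : e ≠ 0 := by
      rintro rfl
      rw [he, zero_dt, mul_zero] at hu0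
      exact hu0 rfl
    have hpair : ∀ a ∈ A, ∀ b ∈ A, a ≠ b → dt a d0 = dt b d0 ∨ dt a d1 = dt b d1 ∨
        dt e (a - b) = 0 := by
      intro a ha b hb hab
      have := hf _ (Dir.of_sub ha hb hab)
      rw [he, mul_eq_zero, mul_eq_zero] at this
      rw [dt_comm a, dt_comm b, dt_comm a, dt_comm b, ← sub_eq_zero, ← dt_sub,
        ← sub_eq_zero (a := dt d1 a), ← dt_sub]
      tauto
    have d1ne : d1 ≠ 0 := by rintro rfl; exact hd1 (cr_zero _)
    have hsum1 : cr d0 (d0 + d1) ≠ 0 := by rw [cr_add, cr_self, zero_add]; exact hd1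
    have hsum2 : cr d1 (d0 + d1) ≠ 0 := by
      rw [cr_add, cr_self, add_zero]; exact fun h => hd1 (cr_eq_zero_comm.mp h)
    by_cases c0 : cr e d0 = 0
    · obtain ⟨t, ht⟩ := par_smul e0 c0
      refine h.symm.three hd1 hsum1 hsum2 (fun a ha b hb hab => ?_)
      rcases hpair a ha b hb hab with h1 | h1 | h1
      · exact Or.inl h1
      · exact Or.inr (Or.inl h1)
      · left
        rw [← sub_eq_zero, ← sub_dt, dt_comm, ht, smul_dt, h1, mul_zero]
    by_cases c1 : cr e d1 = 0
    · obtain ⟨t, ht⟩ := par_smul e0 c1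
      refine h.symm.three hd1 hsum1 hsum2 (fun a ha b hb hab => ?_)
      rcases hpair a ha b hb hab with h1 | h1 | h1
      · exact Or.inl h1
      · exact Or.inr (Or.inl h1)
      · right; left
        rw [← sub_eq_zero, ← sub_dt, dt_comm, ht, smul_dt, h1, mul_zero]
    refine h.symm.three hd1 (fun h => c0 (cr_eq_zero_comm.mp h))
      (fun h => c1 (cr_eq_zero_comm.mp h)) (fun a ha b hb hab => ?_)
    rcases hpair a ha b hb hab with h1 | h1 | h1
    · exact Or.inl h1
    · exact Or.inr (Or.inl h1)
    · right; right
      rw [← sub_eq_zero, ← sub_dt, dt_comm, h1]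
  · push Not at hal
    obtain ⟨v, v0, hdv, hvD⟩ := h.missing hd0
    have hother : ∀ w, dt d0 w = 0 → cr v w ≠ 0 → Dir A w := by
      intro v' hdv' hvv'
      by_contra hvD'
      have v0' : v' ≠ 0 := by rintro rfl; exact hvv' (cr_zero _)
      obtain ⟨o, ho⟩ := exists_dt_one hd0
      have cnt : ∀ g w, g ≠ 0 → dt d0 g = 0 → dt d0 w = 1 → ∀ T : Finset (ZMod 7),
          (∀ t ∈ T, Dir A (w + t • g)) → T.card ≤ 2 := by
        intro g w g0 hg hw T hT
        have hcc : cr d0 (cr g w) ≠ 0 := by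
          rw [cr_cr, hw, hg]; simpa using g0
        have hc0 : cr g w ≠ 0 := by intro h0; rw [h0, cr_zero] at hcc; exact hcc rfl
        exact aff_count hS ((memS g).2 ⟨g0, hz0 g hg⟩) hg hw (hhi _ hc0 (hal _ hcc)) T
          (fun t ht => (memS _).2 ⟨(hT t ht).1, hf _ (hT t ht)⟩)
      have ngw : ∀ g w, g ≠ 0 → dt d0 g = 0 → dt d0 w = 1 → cr g w ≠ 0 := by
        intro g w g0 hg hw hc
        obtain ⟨t, rfl⟩ := par_smul g0 hc
        rw [dt_smul, hg, mul_zero] at hw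
        exact absurd hw (by decide)
      apply lemmaY (univ.filter fun p : ZMod 7 × ZMod 7 => Dir A (p.1 • v + p.2 • v' + o))
      · intro c
        have hw : dt d0 (c • v + o) = 1 := by rw [dt_add, dt_smul, hdv, ho]; ring
        obtain ⟨t, ht⟩ := h.block_line hvD' v0' (ngw v' (c • v + o) v0' hdv' hw)
        refine ⟨(c, t), ?_, rfl⟩
        rw [mem_filter]
        refine ⟨mem_univ _, ?_⟩
        have : c • v + t • v' + o = c • v + o + t • v' := by abel
        rw [this]; exact ht
      · intro c
        have hw : dt d0 (c • v' + o) = 1 := by rw [dt_add, dt_smul, hdv', ho]; ring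
        obtain ⟨t, ht⟩ := h.block_line hvD v0 (ngw v (c • v' + o) v0 hdv hw)
        refine ⟨(t, c), ?_, rfl⟩
        rw [mem_filter]
        refine ⟨mem_univ _, ?_⟩
        have : t • v + c • v' + o = c • v' + o + t • v := by abel
        rw [this]; exact ht
      · intro c
        have hw : dt d0 (c • v + o) = 1 := by rw [dt_add, dt_smul, hdv, ho]; ring
        have := cnt v' (c • v + o) v0' hdv' hw
          (univ.filter fun t : ZMod 7 => Dir A (c • v + o + t • v')) (by simp)
        refine le_trans ?_ this
        refine le_trans (card_le_card ?_) (card_image_le (f := fun t : ZMod 7 => (c, t)))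
        rintro ⟨x, y⟩ hxy
        simp only [mem_filter, mem_univ, true_and] at hxy
        rw [mem_image]
        refine ⟨y, ?_, by rw [hxy.2]⟩
        rw [mem_filter]
        refine ⟨mem_univ _, ?_⟩
        have e : c • v + o + y • v' = x • v + y • v' + o := by rw [hxy.2]; abel
        rw [e]; exact hxy.1
      · intro m c
        have hw : dt d0 (c • v' + o) = 1 := by rw [dt_add, dt_smul, hdv', ho]; ring
        have hg : dt d0 (v + m • v') = 0 := by rw [dt_add, dt_smul, hdv', hdv]; ring
        have hg0 : v + m • v' ≠ 0 := by
          intro h0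
          apply hvv'
          rw [eq_neg_of_add_eq_zero_left h0, ← neg_smul, smul_cr, cr_self, smul_zero]
        have := cnt (v + m • v') (c • v' + o) hg0 hg hw
          (univ.filter fun t : ZMod 7 => Dir A (c • v' + o + t • (v + m • v'))) (by simp)
        refine le_trans ?_ this
        refine le_trans (card_le_card ?_) (card_image_le (f := fun t : ZMod 7 => (t, c + m * t)))
        rintro ⟨x, y⟩ hxy
        simp only [mem_filter, mem_univ, true_and] at hxy
        have hy : y = c + m * x := by rw [← hxy.2]; ring
        rw [mem_image]
        refine ⟨x, ?_, by rw [hy]⟩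
        rw [mem_filter]
        refine ⟨mem_univ _, ?_⟩
        have e : c • v' + o + x • (v + m • v') = x • v + y • v' + o := by
          rw [hy]; module
        rw [e]; exact hxy.1
    obtain ⟨x, hx⟩ : E.Nonempty := by rw [← card_pos, h.cE]; norm_num
    have h7 := (h.seven hd0 v0 hdv (fun u h1 h2 => h.bal (hother u h1 h2)) x hx).1
    have := h.no7 v0 (dt x v)
    omega

theorem fib_sum_fun (E : Finset V3) (u : V3) (g : ZMod 7 → ZMod 7) :
    ∑ x ∈ E, g (dt x u) = ∑ c : ZMod 7, ((E.filter fun x => dt x u = c).card : ZMod 7) * g c := by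
  rw [← sum_fiberwise_of_maps_to (g := fun x => dt x u) (t := univ) (fun x _ => mem_univ _)]
  apply sum_congr rfl
  intro c _
  rw [sum_congr rfl (g := fun _ => g c), sum_const, nsmul_eq_mul]
  intro x hx
  rw [(mem_filter.mp hx).2]

theorem pow_decide : ∀ k : Fin 4, ∑ c : ZMod 7, (2 : ZMod 7) * c ^ (k.val + 1) = 0 := by decide +kernel

theorem bal_pow {E : Finset V3} {u : V3} (h : Bal E u) {k : ℕ} (h1 : 1 ≤ k) (h4 : k ≤ 4) :
    ∑ x ∈ E, (dt x u) ^ k = 0 := by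
  rw [fib_sum_fun E u (fun z => z ^ k)]
  have := pow_decide ⟨k - 1, by omega⟩
  simp only [Nat.sub_add_cancel h1] at this
  rw [← this]
  apply sum_congr rfl
  intro c _
  rw [h c]; rfl

theorem SP.P3 {E A : Finset V3} (h : SP E A) (u : V3) : ∑ x ∈ E, (dt x u) ^ 3 = 0 := by
  have := h.lemmaX E (fun x => x) (fun x => x) (fun x => x) (fun u hu => by
    rw [← bal_pow (h.bal hu) (k := 3) (by norm_num) (by norm_num)]
    apply sum_congr rfl
    intro x _; ring) u
  rw [← this]
  apply sum_congr rfl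
  intro x _; ring

theorem SP.P2 {E A : Finset V3} (h : SP E A) (u : V3) : ∑ x ∈ E, (dt x u) ^ 2 = 0 := by
  by_cases u0 : u = 0
  · rw [u0]; simp [dt_zero]
  obtain ⟨e, he⟩ := exists_dt_one u0
  have := h.lemmaX E (fun x => x) (fun x => x) (fun _ => e) (fun u hu => by
    rw [← sum_mul]
    have := bal_pow (h.bal hu) (k := 2) (by norm_num) (by norm_num)
    simp only [pow_two] at this
    rw [this, zero_mul]) u
  rw [← this]
  apply sum_congr rfl
  intro x _
  rw [dt_comm e u, he]; ring

theorem SP.P1 {E A : Finset V3} (h : SP E A) (u : V3) : ∑ x ∈ E, dt x u = 0 := by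
  by_cases u0 : u = 0
  · rw [u0]; simp [dt_zero]
  obtain ⟨e, he⟩ := exists_dt_one u0
  have := h.lemmaX E (fun x => x) (fun _ => e) (fun _ => e) (fun u hu => by
    rw [← sum_mul, ← sum_mul]
    have := bal_pow (h.bal hu) (k := 1) (by norm_num) (by norm_num)
    simp only [pow_one] at this
    rw [this, zero_mul, zero_mul]) u
  rw [← this]
  apply sum_congr rfl
  intro x _
  rw [dt_comm e u, he]; ring

theorem ind_decide : ∀ y c : ZMod 7, (if y = c then (1 : ZMod 7) else 0) =
    1 - (y ^ 6 + y ^ 5 * c + y ^ 4 * c ^ 2 + y ^ 3 * c ^ 3 + y ^ 2 * c ^ 4 + y * c ^ 5 + c ^ 6) := by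
  decide +kernel

theorem SP.n_quad {E A : Finset V3} (h : SP E A) (u : V3) (c : ZMod 7) :
    ((E.filter fun x => dt x u = c).card : ZMod 7) =
      (-∑ x ∈ E, (dt x u) ^ 4) * c ^ 2 + (-∑ x ∈ E, (dt x u) ^ 5) * c + -∑ x ∈ E, (dt x u) ^ 6 := by
  have h1 := h.P1 u
  have h2 := h.P2 u
  have h3 := h.P3 u
  have h0 : ∑ x ∈ E, (1 - c ^ 6 : ZMod 7) = 0 := by
    rw [sum_const, h.cE]
    have : (14 : ZMod 7) = 0 := by decide
    rw [nsmul_eq_mul]; push_cast; rw [this, zero_mul]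
  rw [card_filter]
  push_cast
  rw [sum_congr rfl (fun x _ => ind_decide (dt x u) c)]
  have : ∑ x ∈ E, (1 - ((dt x u) ^ 6 + (dt x u) ^ 5 * c + (dt x u) ^ 4 * c ^ 2 +
      (dt x u) ^ 3 * c ^ 3 + (dt x u) ^ 2 * c ^ 4 + (dt x u) * c ^ 5 + c ^ 6)) =
      (∑ x ∈ E, (1 - c ^ 6)) - ∑ x ∈ E, (dt x u) ^ 6 - (∑ x ∈ E, (dt x u) ^ 5) * c
      - (∑ x ∈ E, (dt x u) ^ 4) * c ^ 2 - (∑ x ∈ E, (dt x u) ^ 3) * c ^ 3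
      - (∑ x ∈ E, (dt x u) ^ 2) * c ^ 4 - (∑ x ∈ E, (dt x u)) * c ^ 5 := by
    simp only [sum_mul, ← sum_sub_distrib]
    apply sum_congr rfl
    intro x _; ring
  rw [this, h0, h1, h2, h3]
  ring

theorem quad_decide : ∀ a b g : ZMod 7, ∑ c : ZMod 7, (a * c ^ 2 + b * c + g).val = 14 →
    (a = 0 ∧ (∀ c : ZMod 7, (a * c ^ 2 + b * c + g).val = 2)) ∨
    (a ≠ 0 ∧ (∑ c : ZMod 7, (a * c ^ 2 + b * c + g).val ^ 2 = 42 ∨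
      ∑ c : ZMod 7, (a * c ^ 2 + b * c + g).val ^ 2 = 56)) := by
  decide +kernel

theorem SP.dich {E A : Finset V3} (h : SP E A) {u : V3} (u0 : u ≠ 0) :
    (∑ x ∈ E, (dt x u) ^ 4 = 0 ∧ Bal E u ∧
      (E.offDiag.filter fun p => dt u (p.1 - p.2) = 0).card = 14) ∨
    (∑ x ∈ E, (dt x u) ^ 4 ≠ 0 ∧
      ((E.offDiag.filter fun p => dt u (p.1 - p.2) = 0).card = 28 ∨
       (E.offDiag.filter fun p => dt u (p.1 - p.2) = 0).card = 42)) := by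
  have hn : ∀ c, (E.filter fun x => dt x u = c).card = ((-∑ x ∈ E, (dt x u) ^ 4) * c ^ 2 +
      (-∑ x ∈ E, (dt x u) ^ 5) * c + -∑ x ∈ E, (dt x u) ^ 6).val := by
    intro c
    rw [← h.n_quad u c, ZMod.val_natCast_of_lt]
    have := h.no7 u0 c
    omega
  have hs := fib_sum E (fun x => dt x u)
  rw [h.cE, sum_congr rfl (fun c _ => hn c)] at hs
  have ho : (E.offDiag.filter fun p => dt u (p.1 - p.2) = 0).card + 14 =
      ∑ c : ZMod 7, (E.filter fun x => dt x u = c).card ^ 2 := by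
    rw [← offdiag_sq, h.cE]
    congr 2
    apply filter_congr
    intro p _
    rw [dt_sub, sub_eq_zero, dt_comm, dt_comm u]
  rcases quad_decide _ _ _ hs with ⟨h1, h2⟩ | ⟨h1, h2⟩
  · left
    have hb : Bal E u := fun c => (hn c).trans (h2 c)
    refine ⟨neg_eq_zero.mp h1, hb, ?_⟩
    rw [sum_congr rfl (fun c _ => by rw [hb c]), sum_const, card_univ, ZMod.card] at ho
    simp at ho
    exact ho
  · right
    refine ⟨fun h0 => h1 (by rw [h0, neg_zero]), ?_⟩
    rw [sum_congr rfl (fun c _ => by rw [hn c])] at ho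
    omega

def SS (E : Finset V3) : Finset V3 :=
  univ.filter fun u : V3 => u ≠ 0 ∧ ∑ x ∈ E, (dt x u) ^ 4 = 0

theorem mem_SS {E : Finset V3} {u : V3} : u ∈ SS E ↔ u ≠ 0 ∧ ∑ x ∈ E, (dt x u) ^ 4 = 0 := by
  simp [SS]

theorem SS_cone (E : Finset V3) : Cone (SS E) := by
  constructor
  · intro u hu; exact (mem_SS.1 hu).1
  · intro u hu t ht
    rw [mem_SS] at hu ⊢
    refine ⟨smul_ne_zero ht hu.1, ?_⟩
    have := (Form_pow E 4).1 t u
    simp only at this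
    rw [this, hu.2, mul_zero]

theorem SP.SS_le {E A : Finset V3} (h : SP E A) : (SS E).card ≤ 133 := by
  have hS := SS_cone E
  by_contra hlt
  have hhi : ∀ d, d ≠ 0 → ((SS E).filter fun u => dt d u = 0).card ≤ 24 := by
    intro d hd
    obtain ⟨q, q0, hq, hb⟩ := not_all_bal h.cE hd
    refine (Form_pow E 4).card_le (q := q) (by norm_num) hd hq ?_
    intro h0
    rcases h.dich q0 with h1 | h1
    · exact hb h1.2.1
    · exact h1.1 h0
  have hlo : ∀ d, d ≠ 0 → 8 ≤ ((SS E).filter fun u => dt d u = 0).card := by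
    intro d hd
    obtain ⟨a, ha, b, hb, hab, he⟩ := h.blocking d
    have hD := Dir.of_sub ha hb hab
    have hu : a - b ∈ SS E :=
      mem_SS.2 ⟨hD.1, bal_pow (h.bal hD) (by norm_num) (by norm_num)⟩
    have key := hS.through hu
    have hsplit := sum_filter_add_sum_filter_not
      (univ.filter (fun d : V3 => d ≠ 0 ∧ dt (a - b) d = 0)) (fun d' => cr d d' = 0)
      (fun d => ((SS E).filter fun w => dt d w = 0).card)
    rw [key] at hsplit
    have c1 : ((univ.filter (fun d : V3 => d ≠ 0 ∧ dt (a - b) d = 0)).filter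
        (fun d' => cr d d' = 0)).card = 6 := by
      have hcone : Cone (univ.filter (fun d : V3 => d ≠ 0 ∧ dt (a - b) d = 0)) := by
        constructor
        · intro u hu; exact (mem_filter.1 hu).2.1
        · intro u hu t ht
          rw [mem_filter] at hu ⊢
          exact ⟨mem_univ _, smul_ne_zero ht hu.2.1, by rw [dt_smul, hu.2.2, mul_zero]⟩
      apply hcone.par
      rw [mem_filter]
      exact ⟨mem_univ _, hd, by rw [dt_comm]; exact he⟩
    have c2 := card_filter_add_card_filter_not
      (s := univ.filter (fun d : V3 => d ≠ 0 ∧ dt (a - b) d = 0)) (fun d' => cr d d' = 0)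
    rw [c1, card_perp_ne hD.1] at c2
    have s1 : ∑ d' ∈ (univ.filter (fun d : V3 => d ≠ 0 ∧ dt (a - b) d = 0)).filter
        (fun d' => cr d d' = 0), ((SS E).filter fun w => dt d' w = 0).card =
        6 * ((SS E).filter fun w => dt d w = 0).card := by
      rw [sum_congr rfl (g := fun _ => ((SS E).filter fun w => dt d w = 0).card), sum_const, c1,
        smul_eq_mul]
      intro d' hd'
      simp only [mem_filter, mem_univ, true_and] at hd'
      obtain ⟨t, rfl⟩ := par_smul hd hd'.2
      have t0 : t ≠ 0 := by rintro rfl; simp at hd'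
      congr 1
      apply filter_congr
      intro w _
      rw [smul_dt, mul_eq_zero]
      tauto
    have s2 := sum_le_card_nsmul ((univ.filter (fun d : V3 => d ≠ 0 ∧ dt (a - b) d = 0)).filter
        (fun d' => ¬ cr d d' = 0)) (fun d => ((SS E).filter fun w => dt d w = 0).card) 24
        (by
          intro d' hd'
          simp only [mem_filter, mem_univ, true_and] at hd'
          exact hhi d' hd'.1.1)
    rw [smul_eq_mul] at s2
    rw [s1] at hsplit
    omega
  have := hS.ineq 8 24 (fun d hd => ⟨hlo d hd, hhi d hd⟩)
  have h3 : 134 ≤ (SS E).card := by omega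
  obtain ⟨m, hm⟩ := Nat.exists_eq_add_of_le h3
  rw [hm] at this
  nlinarith

open Classical in
theorem SP.false {E A : Finset V3} (h : SP E A) : False := by
  have hs := h.SS_le
  have hs' := h.symm.SS_le
  obtain ⟨I, hI⟩ : ∃ I, I = A.offDiag := ⟨_, rfl⟩
  have cI : I.card = 182 := by rw [hI, offDiag_card, h.cA]
  have hφ : ∀ p ∈ I, p.1 - p.2 ≠ 0 := by
    intro p hp
    rw [hI, mem_offDiag] at hp
    exact sub_ne_zero.mpr hp.2.2
  have k1 := sum_k I (fun p => p.1 - p.2) hφ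
  have k2 := sum_k2 I (fun p => p.1 - p.2) hφ
  obtain ⟨S2, hS2⟩ : ∃ n, n = ((I ×ˢ I).filter fun p => cr (p.1.1 - p.1.2) (p.2.1 - p.2.2) = 0).card :=
    ⟨_, rfl⟩
  rw [← hS2] at k2
  have c342 : (univ.erase (0 : V3)).card = 342 := by
    rw [card_erase_of_mem (mem_univ _), card_V3]
  have k3 : ∑ d ∈ univ.erase (0 : V3), (I.filter fun p => dt d (p.1 - p.2) = 0).card ^ 2 + 1176 * 342
      = 70 * (∑ d ∈ univ.erase (0 : V3), (I.filter fun p => dt d (p.1 - p.2) = 0).card)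
        + 392 * (SS A).card := by
    have e1 : (SS A).card = ∑ d ∈ univ.erase (0 : V3), if d ∈ SS A then 1 else 0 := by
      rw [← card_filter]
      refine congrArg card ?_
      ext d
      simp only [mem_filter, mem_erase, mem_univ, and_true]
      constructor
      · intro hd; exact ⟨(mem_SS.1 hd).1, hd⟩
      · exact fun hd => hd.2
    have e2 : 1176 * 342 = ∑ d ∈ univ.erase (0 : V3), 1176 := by
      rw [sum_const, c342, smul_eq_mul]
    rw [e1, e2, mul_sum, mul_sum, ← sum_add_distrib, ← sum_add_distrib]
    apply sum_congr rfl
    intro d hd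
    have d0 := ne_of_mem_erase hd
    rw [hI]
    rcases h.symm.dich d0 with ⟨h1, h2, h3⟩ | ⟨h1, h3⟩
    · rw [if_pos (mem_SS.2 ⟨d0, h1⟩), h3]; norm_num
    · rw [if_neg (fun hh => h1 (mem_SS.1 hh).2)]
      rcases h3 with h3 | h3 <;> rw [h3] <;> norm_num
  rw [k1, k2, cI] at k3
  -- directions
  obtain ⟨D, hD⟩ : ∃ D, D = univ.filter fun u : V3 => Dir A u := ⟨_, rfl⟩
  have hDc : Cone D := by
    constructor
    · intro u hu; rw [hD, mem_filter] at hu; exact hu.2.1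
    · intro u hu t ht
      rw [hD, mem_filter] at hu ⊢
      exact ⟨mem_univ _, hu.2.smul ht⟩
  have hDS : D.card ≤ 133 := by
    refine le_trans (card_le_card ?_) hs
    intro u hu
    rw [hD, mem_filter] at hu
    exact mem_SS.2 ⟨hu.2.1, bal_pow (h.bal hu.2) (by norm_num) (by norm_num)⟩
  have hID : ∀ p ∈ I, p.1 - p.2 ∈ D := by
    intro p hp
    rw [hI, mem_offDiag] at hp
    rw [hD, mem_filter]
    exact ⟨mem_univ _, Dir.of_sub hp.1 hp.2.1 hp.2.2⟩
  have w1 : ∑ u ∈ D, (I.filter fun p => cr (p.1 - p.2) u = 0).card = 1092 := by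
    rw [dc, sum_congr rfl (g := fun _ => 6), sum_const, cI, smul_eq_mul]
    intro p hp
    exact hDc.par (hID p hp)
  have w2 : ∑ u ∈ D, (I.filter fun p => cr (p.1 - p.2) u = 0).card ^ 2 = 6 * S2 := by
    have h1 : ∀ u ∈ D, (I.filter fun p => cr (p.1 - p.2) u = 0).card ^ 2 =
        ((I ×ˢ I).filter fun p => cr (p.1.1 - p.1.2) u = 0 ∧ cr (p.2.1 - p.2.2) u = 0).card := by
      intro u _
      rw [sq, ← card_product, ← filter_product]
    rw [sum_congr rfl h1, dc, hS2, card_filter, mul_sum]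
    apply sum_congr rfl
    intro p hp
    rw [mem_product] at hp
    split_ifs with hc
    · refine Eq.trans ?_ (hDc.par (hID _ hp.1))
      refine congrArg card ?_
      apply filter_congr
      intro u _
      constructor
      · exact fun h => h.1
      · intro h1
        refine ⟨h1, ?_⟩
        obtain ⟨t, ht⟩ := par_smul (hφ _ hp.1) hc
        rw [ht, smul_cr, h1, smul_zero]
    · rw [mul_zero, card_eq_zero, filter_eq_empty_iff]
      rintro u hu ⟨h1, h2⟩
      apply hc
      have u0 := hDc.1 u hu
      obtain ⟨t, ht⟩ := par_smul u0 (cr_eq_zero_comm.mp h1)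
      rw [ht, smul_cr, cr_eq_zero_comm.mp h2, smul_zero]
  have cs := sq_sum_le_card_mul_sum_sq (s := D)
    (f := fun u => (I.filter fun p => cr (p.1 - p.2) u = 0).card)
  rw [w1, w2] at cs
  have cs2 : 1092 ^ 2 ≤ 133 * (6 * S2) := cs.trans (Nat.mul_le_mul_right _ hDS)
  omega

noncomputable def om : ℂ := Complex.exp (2 * (Real.pi : ℂ) * Complex.I / ((7 : ℕ) : ℂ))

theorem om_prim : IsPrimitiveRoot om 7 := Complex.isPrimitiveRoot_exp 7 (by norm_num)

noncomputable def ex (z : ZMod 7) : ℂ := ZMod.stdAddChar z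

theorem ex_eq (z : ZMod 7) : ex z = om ^ z.val := by
  have h1 : z = ((z.val : ℤ) : ZMod 7) := by simp
  have h2 : ex z = Complex.exp (2 * (Real.pi : ℂ) * Complex.I * (z.val : ℤ) / ((7 : ℕ) : ℂ)) := by
    rw [← ZMod.stdAddChar_coe, ← h1]; rfl
  rw [h2, om, ← Complex.exp_nat_mul]
  congr 1
  push_cast
  ring

theorem chr_ex (a x : V3) : chr 7 a x = ex (dt x a) := by
  have : ∑ i, x i * a i = dt x a := by
    rw [Fin.sum_univ_three]; rfl
  rw [chr, this, ex_eq, om, ← Complex.exp_nat_mul]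
  congr 1
  ring

theorem ex_conj (z w : ZMod 7) : ex z * (starRingEnd ℂ) (ex w) = ex (z - w) := by
  unfold ex
  rw [← AddChar.map_neg_eq_conj, ← AddChar.map_add_eq_mul, sub_eq_add_neg]

theorem ex_zero : ex 0 = 1 := AddChar.map_zero_eq_one _

theorem bal_of_sum {E : Finset V3} (hE : E.card = 14) {u : V3} (h : ∑ x ∈ E, ex (dt x u) = 0) :
    Bal E u := by
  have h1 : ∑ x ∈ E, ex (dt x u) =
      ∑ c : ZMod 7, ((E.filter fun x => dt x u = c).card : ℂ) * ex c := by
    rw [← sum_fiberwise_of_maps_to (g := fun x => dt x u) (t := univ) (fun x _ => mem_univ _)]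
    apply sum_congr rfl
    intro c _
    rw [sum_congr rfl (g := fun _ => ex c), sum_const, nsmul_eq_mul]
    intro x hx
    rw [(mem_filter.mp hx).2]
  rw [h1] at h
  let n : ZMod 7 → ℤ := fun c => ((E.filter fun x => dt x u = c).card : ℤ)
  have h2 := (om_prim.sum_eq_zero_iff_forall_eq_int (by norm_num) (n : Fin 7 → ℤ)).1 (by
      have h' : ∑ c : ZMod 7, ((n c : ℤ) : ℂ) * om ^ c.val = 0 := by
        rw [← h]
        apply sum_congr rfl
        intro c _
        rw [ex_eq]
        simp [n]
      exact h')
  have h3 : ∀ c c' : ZMod 7, (E.filter fun x => dt x u = c).card =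
      (E.filter fun x => dt x u = c').card := by
    intro c c'
    exact Int.ofNat_inj.mp (h2 c c')
  intro c
  have h4 := fib_sum E (fun x => dt x u)
  rw [hE, sum_congr rfl (fun c' _ => h3 c' c), sum_const, card_univ, ZMod.card, smul_eq_mul] at h4
  omega

theorem SP_of_pair {E A : Finset V3} (hE : E.card = 14) (h : IsSpectralPair 7 E A) : SP E A := by
  obtain ⟨h1, h2, h3⟩ := h
  have hc : Fintype.card A = Fintype.card E := by
    let M : Matrix E A ℂ := Matrix.of fun x a => chr 7 a.1 x.1
    have hM : ∀ c x, M.mulVecLin c x = ∑ a : A, c a * chr 7 a.1 x.1 := by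
      intro c x
      simp only [Matrix.mulVecLin_apply, Matrix.mulVec, dotProduct, M, Matrix.of_apply]
      apply sum_congr rfl
      intro a _
      ring
    have hb : Function.Bijective M.mulVecLin := by
      constructor
      · rw [injective_iff_map_eq_zero]
        intro c hc
        funext a
        exact h3 c (fun x => by rw [← hM, hc]; rfl) a
      · intro f
        obtain ⟨c, hc⟩ := h2 f
        exact ⟨c, funext fun x => by rw [hM, hc x]⟩
    have := (LinearEquiv.ofBijective M.mulVecLin hb).finrank_eq
    rwa [Module.finrank_fintype_fun_eq_card, Module.finrank_fintype_fun_eq_card] at this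
  have cA : A.card = 14 := by
    rw [Fintype.card_coe, Fintype.card_coe] at hc
    rw [hc, hE]
  have or1 : ∀ a ∈ A, ∀ b ∈ A, a ≠ b → ∑ x ∈ E, ex (dt x (a - b)) = 0 := by
    intro a ha b hb hab
    rw [← h1 a ha b hb hab]
    apply sum_congr rfl
    intro x _
    rw [chr_ex, chr_ex, ex_conj, dt_sub]
  let M : Matrix A E ℂ := Matrix.of fun a x => ex (dt x.1 a.1)
  let N : Matrix E A ℂ := Matrix.of fun x a => (1 / 14 : ℂ) * (starRingEnd ℂ) (ex (dt x.1 a.1))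
  have hMN : M * N = 1 := by
    ext a b
    rw [Matrix.mul_apply]
    have e1 : ∑ x : E, M a x * N x b = (1 / 14 : ℂ) * ∑ x ∈ E, ex (dt x (a.1 - b.1)) := by
      rw [← sum_coe_sort E, mul_sum]
      apply sum_congr rfl
      intro x _
      rw [dt_sub, ← ex_conj]
      simp only [M, N, Matrix.of_apply]
      ring
    rw [e1]
    by_cases hab : a = b
    · rw [hab, sub_self, Matrix.one_apply_eq]
      simp only [dt_zero, ex_zero, sum_const, hE]
      norm_num
    · rw [or1 a.1 a.2 b.1 b.2 (fun h => hab (Subtype.ext h)), mul_zero, Matrix.one_apply_ne hab]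
  have hNM := (Matrix.mul_eq_one_comm_of_card_eq _ _ _ hc).1 hMN
  refine ⟨hE, cA, fun a ha b hb hab => bal_of_sum hE (or1 a ha b hb hab), ?_⟩
  intro x hx y hy hxy
  apply bal_of_sum cA
  have e := congrFun (congrFun hNM ⟨y, hy⟩) ⟨x, hx⟩
  rw [Matrix.mul_apply, Matrix.one_apply_ne (fun h => hxy (congrArg Subtype.val h).symm)] at e
  have e1 : ∑ a : A, N ⟨y, hy⟩ a * M a ⟨x, hx⟩ = (1 / 14 : ℂ) * ∑ a ∈ A, ex (dt a (x - y)) := by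
    rw [← sum_coe_sort A, mul_sum]
    apply sum_congr rfl
    intro a _
    rw [dt_sub, ← ex_conj, dt_comm a.1 x, dt_comm a.1 y]
    simp only [M, N, Matrix.of_apply]
    ring
  rw [e1] at e
  exact (mul_eq_zero.mp e).resolve_left (by norm_num)


/-- There is no spectral set of size 14 in `𝔽_7^3`. -/
theorem no_spectral_of_card_14 (E : Finset (Fin 3 → ZMod 7)) (hE : E.card = 14) :
    ¬ IsSpectral 7 E := by
  rintro ⟨A, hA⟩
  exact (SP_of_pair hE hA).false
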